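/- arXiv:2501.07732 — 2 statements merged into one kernel-verified Lean document; each statement's English description precedes it below -/
import Mathlib

section
/- Existence of the γ-limit: Assume (H1) and (H2)[α] for a fixed α ∈ (1/3,1). Then for every smooth characteristic function F of [1,∞), the limit lim_{t→∞} Γ_{F,α}(t) exists (i.e. the function t ↦ Γ_{F,α}(t), t ≥ 1, converges to a real number as t → ∞). -/
noncomputable section

open MeasureTheory Filter Topology Real

abbrev R3 : Type := EuclideanSpace ℝ (Fin 3)

/-- `F` is a smooth characteristic function of `[1, ∞)`:
smooth, nondecreasing, `F = 0` on `(-∞, 1/2]`, `F = 1` on `[1, ∞)`, values in `[0,1]`. -/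
def IsSmoothChar (F : ℝ → ℝ) : Prop :=
  ContDiff ℝ (⊤ : ℕ∞) F ∧ Monotone F ∧ (∀ x : ℝ, x ≤ 1 / 2 → F x = 0) ∧
    (∀ x : ℝ, 1 ≤ x → F x = 1) ∧ ∀ x : ℝ, 0 ≤ F x ∧ F x ≤ 1

/-- `g(x) = β(|x|)` with `β` smooth, nondecreasing and convex on `[0,∞)`,
`β r = r` for `r ≥ 2`, and `β` constant on `[0,1]`. -/
structure GoodG (g : R3 → ℝ) (β : ℝ → ℝ) : Prop where
  smooth_g : ContDiff ℝ (⊤ : ℕ∞) g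
  smooth_beta : ContDiff ℝ (⊤ : ℕ∞) β
  mono_beta : MonotoneOn β (Set.Ici 0)
  convex_beta : ConvexOn ℝ (Set.Ici 0) β
  beta_eq_id : ∀ r : ℝ, 2 ≤ r → β r = r
  beta_const : ∀ r ∈ Set.Icc (0 : ℝ) 1, β r = β 0
  g_eq : ∀ x : R3, g x = β ‖x‖

/-- The (pointwise) Laplacian of `ψ : ℝ³ → ℂ`. -/
def laplacian (ψ : R3 → ℂ) (x : R3) : ℂ :=
  ∑ j : Fin 3,
    fderiv ℝ (fun y => fderiv ℝ ψ y (EuclideanSpace.single j 1)) x (EuclideanSpace.single j 1)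

/-- The quadratic form `⟨γ⟩_ψ = Im ∫ conj ψ (∇g · ∇ψ)` of `γ = ½(∇g·p + p·∇g)`. -/
def gammaExp (g : R3 → ℝ) (ψ : R3 → ℂ) : ℝ :=
  (∫ x : R3, (starRingEnd ℂ) (ψ x) * fderiv ℝ ψ x (gradient g x)).im

/-- `Γ_{F,α}(t) = ⟨γ⟩_ψ` with `ψ = F(⟨·⟩/t^α)·φ(t,·)`. -/
def GammaF (g : R3 → ℝ) (φ : ℝ → R3 → ℂ) (F : ℝ → ℝ) (α t : ℝ) : ℝ :=
  gammaExp g fun x => (F (g x / t ^ α) : ℂ) * φ t x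

/-- The standing hypotheses on the solution `φ` of `i∂_tφ + Δφ = 𝒩(|φ|,|x|,t)φ`,
including the global `H¹` bound (H1). -/
structure SolSetting (N : ℝ → ℝ → ℝ → ℝ) (φ : ℝ → R3 → ℂ) : Prop where
  smooth : ContDiffOn ℝ (⊤ : ℕ∞) (fun p : ℝ × R3 => φ p.1 p.2) (Set.Ici 0 ×ˢ Set.univ)
  radial : ∀ t : ℝ, ∀ x y : R3, ‖x‖ = ‖y‖ → φ t x = φ t y
  eqn : ∀ t : ℝ, 0 ≤ t → ∀ x : R3,
    Complex.I * deriv (fun s => φ s x) t + laplacian (φ t) x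
      = (N ‖φ t x‖ ‖x‖ t : ℂ) * φ t x
  l2 : ∀ t : ℝ, 0 ≤ t → Integrable fun x : R3 => ‖φ t x‖ ^ 2
  grad_l2 : ∀ t : ℝ, 0 ≤ t → Integrable fun x : R3 => ‖fderiv ℝ (φ t) x‖ ^ 2
  wt_l2 : ∀ t : ℝ, 0 ≤ t → Integrable fun x : R3 => (1 + ‖x‖) * ‖φ t x‖ ^ 2
  H1 : ∃ C : ℝ, ∀ t : ℝ, 0 ≤ t →
    (∫ x : R3, ‖φ t x‖ ^ 2) + (∫ x : R3, ‖fderiv ℝ (φ t) x‖ ^ 2) ≤ C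

/-- Hypothesis (H2)[α, β₀]: uniform decay of the interaction in the exterior region. -/
def H2 (g : R3 → ℝ) (N : ℝ → ℝ → ℝ → ℝ) (φ : ℝ → R3 → ℂ) (α β₀ : ℝ) : Prop :=
  ∀ F : ℝ → ℝ, IsSmoothChar F → ∃ C > (0 : ℝ), ∀ t : ℝ, 1 ≤ t → ∀ x : R3,
    |F (g x / t ^ α) * N ‖φ t x‖ ‖x‖ t| ≤ C * t ^ (-β₀)

open scoped ContDiff

/-- The open half space `t > 0` in the `(t, r)` plane. -/
def Om : Set (ℝ × ℝ) := Set.Ioi 0 ×ˢ Set.univ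

lemma isOpen_Om : IsOpen Om := isOpen_Ioi.prod isOpen_univ

def Dt (u : ℝ × ℝ → ℝ) (p : ℝ × ℝ) : ℝ := fderiv ℝ u p (1, 0)
def Dr (u : ℝ × ℝ → ℝ) (p : ℝ × ℝ) : ℝ := fderiv ℝ u p (0, 1)

lemma Dt_smooth {u : ℝ × ℝ → ℝ} (hu : ContDiffOn ℝ ∞ u Om) : ContDiffOn ℝ ∞ (Dt u) Om := by
  have := hu.fderiv_of_isOpen (m := ∞) isOpen_Om (by simp)
  exact this.clm_apply contDiffOn_const

lemma Dr_smooth {u : ℝ × ℝ → ℝ} (hu : ContDiffOn ℝ ∞ u Om) : ContDiffOn ℝ ∞ (Dr u) Om := by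
  have := hu.fderiv_of_isOpen (m := ∞) isOpen_Om (by simp)
  exact this.clm_apply contDiffOn_const

lemma diffAt_Om {u : ℝ × ℝ → ℝ} (hu : ContDiffOn ℝ ∞ u Om) {p : ℝ × ℝ} (hp : p ∈ Om) :
    DifferentiableAt ℝ u p :=
  (hu.contDiffAt (isOpen_Om.mem_nhds hp)).differentiableAt (by simp)

lemma Dt_mul {u v : ℝ × ℝ → ℝ} {p : ℝ × ℝ} (hu : DifferentiableAt ℝ u p)
    (hv : DifferentiableAt ℝ v p) : Dt (u * v) p = Dt u p * v p + u p * Dt v p := by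
  simp [Dt, fderiv_mul hu hv]; ring
lemma Dr_mul {u v : ℝ × ℝ → ℝ} {p : ℝ × ℝ} (hu : DifferentiableAt ℝ u p)
    (hv : DifferentiableAt ℝ v p) : Dr (u * v) p = Dr u p * v p + u p * Dr v p := by
  simp [Dr, fderiv_mul hu hv]; ring
lemma Dt_add {u v : ℝ × ℝ → ℝ} {p : ℝ × ℝ} (hu : DifferentiableAt ℝ u p)
    (hv : DifferentiableAt ℝ v p) : Dt (u + v) p = Dt u p + Dt v p := by
  simp [Dt, fderiv_add hu hv]
lemma Dr_add {u v : ℝ × ℝ → ℝ} {p : ℝ × ℝ} (hu : DifferentiableAt ℝ u p)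
    (hv : DifferentiableAt ℝ v p) : Dr (u + v) p = Dr u p + Dr v p := by
  simp [Dr, fderiv_add hu hv]
lemma Dt_sub {u v : ℝ × ℝ → ℝ} {p : ℝ × ℝ} (hu : DifferentiableAt ℝ u p)
    (hv : DifferentiableAt ℝ v p) : Dt (u - v) p = Dt u p - Dt v p := by
  simp [Dt, fderiv_sub hu hv]
lemma Dr_sub {u v : ℝ × ℝ → ℝ} {p : ℝ × ℝ} (hu : DifferentiableAt ℝ u p)
    (hv : DifferentiableAt ℝ v p) : Dr (u - v) p = Dr u p - Dr v p := by
  simp [Dr, fderiv_sub hu hv]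

lemma Dt_Dr_comm {u : ℝ × ℝ → ℝ} (hu : ContDiffOn ℝ ∞ u Om) {p : ℝ × ℝ} (hp : p ∈ Om) :
    Dt (Dr u) p = Dr (Dt u) p := by
  have h := (hu.contDiffAt (isOpen_Om.mem_nhds hp)).isSymmSndFDerivAt
    (by simpa using (show ((2 : ℕ∞) : WithTop ℕ∞) ≤ ∞ from WithTop.coe_le_coe.2 le_top))
  have hd : DifferentiableAt ℝ (fderiv ℝ u) p :=
    ((hu.fderiv_of_isOpen (m := ∞) isOpen_Om (by simp)).contDiffAt
      (isOpen_Om.mem_nhds hp)).differentiableAt (by simp)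
  have e : ∀ v w : ℝ × ℝ, fderiv ℝ (fun q => fderiv ℝ u q v) p w = fderiv ℝ (fderiv ℝ u) p w v := by
    intro v w
    rw [fderiv_clm_apply hd (differentiableAt_const _)]
    simp
  show fderiv ℝ (fun q => fderiv ℝ u q (0,1)) p (1,0) = fderiv ℝ (fun q => fderiv ℝ u q (1,0)) p (0,1)
  rw [e, e, h]

/-- the error density -/
def Een (a b w : ℝ × ℝ → ℝ) (p : ℝ × ℝ) : ℝ :=
  Dt w p * (a p * Dr b p - b p * Dr a p) + 2 * Dr w p * (Dr a p ^ 2 + Dr b p ^ 2)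
    - 1 / 2 * Dr (Dr (Dr w)) p * (a p ^ 2 + b p ^ 2)
    + Dr w p * (a p * (Dr (Dr a) p - Dt b p) + b p * (Dr (Dr b) p + Dt a p))
    + 2 * w p * (Dr a p * (Dr (Dr a) p - Dt b p) + Dr b p * (Dr (Dr b) p + Dt a p))

def Jfun (a b w : ℝ × ℝ → ℝ) : ℝ × ℝ → ℝ := w * (a * Dr b - b * Dr a)

def Kfun (a b w : ℝ × ℝ → ℝ) : ℝ × ℝ → ℝ :=
  (Dr w * (a * Dr a + b * Dr b) + w * (Dr a * Dr a + Dr b * Dr b)) -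
    (w * (a * Dt b - b * Dt a) + (fun _ => (1 / 2 : ℝ)) * (Dr (Dr w) * (a * a + b * b)))

lemma Jfun_smooth {a b w : ℝ × ℝ → ℝ} (ha : ContDiffOn ℝ ∞ a Om) (hb : ContDiffOn ℝ ∞ b Om)
    (hw : ContDiffOn ℝ ∞ w Om) : ContDiffOn ℝ ∞ (Jfun a b w) Om :=
  hw.mul ((ha.mul (Dr_smooth hb)).sub (hb.mul (Dr_smooth ha)))

lemma Kfun_smooth {a b w : ℝ × ℝ → ℝ} (ha : ContDiffOn ℝ ∞ a Om) (hb : ContDiffOn ℝ ∞ b Om)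
    (hw : ContDiffOn ℝ ∞ w Om) : ContDiffOn ℝ ∞ (Kfun a b w) Om :=
  (((Dr_smooth hw).mul ((ha.mul (Dr_smooth ha)).add (hb.mul (Dr_smooth hb)))).add
    (hw.mul (((Dr_smooth ha).mul (Dr_smooth ha)).add ((Dr_smooth hb).mul (Dr_smooth hb))))).sub
    ((hw.mul ((ha.mul (Dt_smooth hb)).sub (hb.mul (Dt_smooth ha)))).add
      (contDiffOn_const.mul ((Dr_smooth (Dr_smooth hw)).mul ((ha.mul ha).add (hb.mul hb)))))

lemma div_identity {a b w : ℝ × ℝ → ℝ} (ha : ContDiffOn ℝ ∞ a Om) (hb : ContDiffOn ℝ ∞ b Om)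
    (hw : ContDiffOn ℝ ∞ w Om) {p : ℝ × ℝ} (hp : p ∈ Om) :
    Dt (Jfun a b w) p + Dr (Kfun a b w) p = Een a b w p := by
  have da := diffAt_Om ha hp
  have db := diffAt_Om hb hp
  have dw := diffAt_Om hw hp
  have dar := diffAt_Om (Dr_smooth ha) hp
  have dbr := diffAt_Om (Dr_smooth hb) hp
  have dwr := diffAt_Om (Dr_smooth hw) hp
  have dwrr := diffAt_Om (Dr_smooth (Dr_smooth hw)) hp
  have dat := diffAt_Om (Dt_smooth ha) hp
  have dbt := diffAt_Om (Dt_smooth hb) hp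
  have dc : DifferentiableAt ℝ (fun _ : ℝ × ℝ => (1 / 2 : ℝ)) p := differentiableAt_const _
  have hc : Dr (fun _ => (1 / 2 : ℝ)) p = 0 := by simp [Dr]
  have ca := Dt_Dr_comm ha hp
  have cb := Dt_Dr_comm hb hp
  unfold Jfun Kfun Een
  rw [Dt_mul dw ((da.mul dbr).sub (db.mul dar)), Dt_sub (da.mul dbr) (db.mul dar), Dt_mul da dbr,
    Dt_mul db dar,
    Dr_sub (((dwr.mul ((da.mul dar).add (db.mul dbr))).add
    (dw.mul ((dar.mul dar).add (dbr.mul dbr))))) ((dw.mul ((da.mul dbt).sub (db.mul dat))).add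
      (dc.mul (dwrr.mul ((da.mul da).add (db.mul db))))),
    Dr_add (dwr.mul ((da.mul dar).add (db.mul dbr)))
      (dw.mul ((dar.mul dar).add (dbr.mul dbr))),
    Dr_add (dw.mul ((da.mul dbt).sub (db.mul dat)))
      (dc.mul (dwrr.mul ((da.mul da).add (db.mul db)))),
    Dr_mul dwr ((da.mul dar).add (db.mul dbr)), Dr_mul dw ((dar.mul dar).add (dbr.mul dbr)),
    Dr_mul dw ((da.mul dbt).sub (db.mul dat)),
    Dr_mul dc (dwrr.mul ((da.mul da).add (db.mul db))), Dr_mul dwrr ((da.mul da).add (db.mul db)),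
    Dr_add (da.mul dar) (db.mul dbr), Dr_add (dar.mul dar) (dbr.mul dbr),
    Dr_sub (da.mul dbt) (db.mul dat), Dr_add (da.mul da) (db.mul db),
    Dr_mul da dar, Dr_mul db dbr, Dr_mul dar dar, Dr_mul dbr dbr, Dr_mul da dbt, Dr_mul db dat,
    Dr_mul da da, Dr_mul db db, hc, ca, cb]
  simp only [Pi.mul_apply, Pi.add_apply, Pi.sub_apply]
  ring

def Qen (a b : ℝ × ℝ → ℝ) (p : ℝ × ℝ) : ℝ := a p ^ 2 + b p ^ 2 + (Dr a p ^ 2 + Dr b p ^ 2)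

lemma Qen_smooth {a b : ℝ × ℝ → ℝ} (ha : ContDiffOn ℝ ∞ a Om) (hb : ContDiffOn ℝ ∞ b Om) :
    ContDiffOn ℝ ∞ (Qen a b) Om :=
  ((ha.pow 2).add (hb.pow 2)).add (((Dr_smooth ha).pow 2).add ((Dr_smooth hb).pow 2))

lemma core_ineq {a b w : ℝ × ℝ → ℝ} (ha : ContDiffOn ℝ ∞ a Om) (hb : ContDiffOn ℝ ∞ b Om)
    (hw : ContDiffOn ℝ ∞ w Om) {t₁ t₂ r₁ r₂ : ℝ} (ht₁ : 0 < t₁) (ht : t₁ ≤ t₂) (hr : r₁ ≤ r₂)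
    (hw1 : ∀ t ∈ Set.Icc t₁ t₂, w (t, r₁) = 0 ∧ Dr w (t, r₁) = 0 ∧ Dr (Dr w) (t, r₁) = 0)
    (hw2 : ∀ t ∈ Set.Icc t₁ t₂, w (t, r₂) = 0 ∧ Dr w (t, r₂) = 0 ∧ Dr (Dr w) (t, r₂) = 0)
    (h : ℝ → ℝ) (hh : ContinuousOn h (Set.Icc t₁ t₂)) (hh0 : ∀ t ∈ Set.Icc t₁ t₂, 0 ≤ h t)
    (hE : ∀ t ∈ Set.Icc t₁ t₂, ∀ r ∈ Set.Icc r₁ r₂, - (h t * Qen a b (t, r)) ≤ Een a b w (t, r))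
    (C : ℝ) (hC : ∀ t ∈ Set.Icc t₁ t₂, ∫ r in r₁..r₂, Qen a b (t, r) ≤ C) :
    - (C * ∫ t in t₁..t₂, h t) ≤
      (∫ r in r₁..r₂, Jfun a b w (t₂, r)) - ∫ r in r₁..r₂, Jfun a b w (t₁, r) := by
  have hbox : Set.uIcc t₁ t₂ ×ˢ Set.uIcc r₁ r₂ ⊆ Om := by
    rw [Set.uIcc_of_le ht]
    rintro ⟨x, y⟩ ⟨hx, _⟩
    exact ⟨lt_of_lt_of_le ht₁ hx.1, trivial⟩
  have hJ := Jfun_smooth ha hb hw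
  have hK := Kfun_smooth ha hb hw
  have hcont : ContinuousOn (fun p => Dt (Jfun a b w) p + Dr (Kfun a b w) p) Om :=
    (Dt_smooth hJ).continuousOn.add (Dr_smooth hK).continuousOn
  have hcomp : IsCompact (Set.uIcc t₁ t₂ ×ˢ Set.uIcc r₁ r₂) := isCompact_uIcc.prod isCompact_uIcc
  have hbox' : ∀ x ∈ Set.Ioo (min t₁ t₂) (max t₁ t₂) ×ˢ Set.Ioo (min r₁ r₂) (max r₁ r₂), x ∈ Om := by
    rintro ⟨x, y⟩ ⟨hx, hy⟩
    exact hbox ⟨⟨hx.1.le, hx.2.le⟩, ⟨hy.1.le, hy.2.le⟩⟩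
  have key := integral2_divergence_prod_of_hasFDerivAt (Jfun a b w) (Kfun a b w)
    (fderiv ℝ (Jfun a b w)) (fderiv ℝ (Kfun a b w)) t₁ r₁ t₂ r₂
    (hJ.continuousOn.mono hbox) (hK.continuousOn.mono hbox)
    (fun x hx => (diffAt_Om hJ (hbox' x hx)).hasFDerivAt)
    (fun x hx => (diffAt_Om hK (hbox' x hx)).hasFDerivAt)
    ((hcont.mono hbox).integrableOn_compact hcomp)
  have hk1 : ∫ x in t₁..t₂, Kfun a b w (x, r₁) = 0 := by
    rw [intervalIntegral.integral_congr (g := fun _ => (0:ℝ))]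
    · simp
    · intro x hx
      rw [Set.uIcc_of_le ht] at hx
      obtain ⟨h1, h2, h3⟩ := hw1 x hx
      simp [Kfun, h1, h2, h3]
  have hk2 : ∫ x in t₁..t₂, Kfun a b w (x, r₂) = 0 := by
    rw [intervalIntegral.integral_congr (g := fun _ => (0:ℝ))]
    · simp
    · intro x hx
      rw [Set.uIcc_of_le ht] at hx
      obtain ⟨h1, h2, h3⟩ := hw2 x hx
      simp [Kfun, h1, h2, h3]
  rw [hk1, hk2] at key
  have key2 : (∫ r in r₁..r₂, Jfun a b w (t₂, r)) - ∫ r in r₁..r₂, Jfun a b w (t₁, r) =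
      ∫ x in t₁..t₂, ∫ y in r₁..r₂, Dt (Jfun a b w) (x, y) + Dr (Kfun a b w) (x, y) := by
    have := key.symm
    simp only [sub_zero, zero_add] at this
    exact this
  rw [key2, ← intervalIntegral.integral_const_mul, ← intervalIntegral.integral_neg]
  have hslice : ∀ (u : ℝ × ℝ → ℝ), ContinuousOn u Om → ∀ x ∈ Set.Icc t₁ t₂,
      IntervalIntegrable (fun y => u (x, y)) volume r₁ r₂ := by
    intro u hu x hx
    apply ContinuousOn.intervalIntegrable
    apply hu.comp (by fun_prop)
    intro y _
    exact ⟨lt_of_lt_of_le ht₁ hx.1, trivial⟩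
  apply intervalIntegral.integral_mono_on ht
  · apply ContinuousOn.intervalIntegrable
    rw [Set.uIcc_of_le ht]
    exact (continuousOn_const.mul hh).neg
  · rw [intervalIntegrable_iff_integrableOn_Ioc_of_le ht]
    simp only [intervalIntegral.integral_of_le hr]
    have hI : IntegrableOn (fun p => Dt (Jfun a b w) p + Dr (Kfun a b w) p)
        (Set.Ioc t₁ t₂ ×ˢ Set.Ioc r₁ r₂) := by
      apply ((hcont.mono hbox).integrableOn_compact hcomp).mono_set
      rw [Set.uIcc_of_le ht, Set.uIcc_of_le hr]
      exact Set.prod_mono Set.Ioc_subset_Icc_self Set.Ioc_subset_Icc_self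
    rw [IntegrableOn, Measure.volume_eq_prod, ← Measure.prod_restrict] at hI
    exact hI.integral_prod_left
  · intro x hx
    have h1 : ∫ y in r₁..r₂, -(h x * Qen a b (x, y)) ≤
        ∫ y in r₁..r₂, Dt (Jfun a b w) (x, y) + Dr (Kfun a b w) (x, y) := by
      apply intervalIntegral.integral_mono_on hr
      · exact ((hslice _ (Qen_smooth ha hb).continuousOn x hx).const_mul _).neg
      · exact hslice _ hcont x hx
      · intro y hy
        rw [div_identity ha hb hw ⟨lt_of_lt_of_le ht₁ hx.1, trivial⟩]
        exact hE x hx y hy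
    rw [intervalIntegral.integral_neg, intervalIntegral.integral_const_mul] at h1
    refine le_trans ?_ h1
    have := mul_le_mul_of_nonneg_left (hC x hx) (hh0 x hx)
    linarith

lemma deriv_smooth {f : ℝ → ℝ} (hf : ContDiff ℝ ∞ f) : ContDiff ℝ ∞ (deriv f) := by
  have := (contDiff_infty_iff_deriv (𝕜 := ℝ)).1 hf
  exact this.2

lemma deriv_out {f : ℝ → ℝ} {c d : ℝ} (h1 : ∀ x < 1/2, f x = c) (h2 : ∀ x, 1 < x → f x = d) :
    (∀ x < 1/2, deriv f x = 0) ∧ ∀ x, 1 < x → deriv f x = 0 := by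
  constructor
  · intro x hx
    have : f =ᶠ[𝓝 x] fun _ => c := by
      filter_upwards [Iio_mem_nhds hx] with y hy using h1 y hy
    rw [this.deriv_eq]; simp
  · intro x hx
    have : f =ᶠ[𝓝 x] fun _ => d := by
      filter_upwards [Ioi_mem_nhds hx] with y hy using h2 y hy
    rw [this.deriv_eq]; simp

lemma out_bdd {f : ℝ → ℝ} (hf : ContDiff ℝ ∞ f) (h1 : ∀ x < 1/2, f x = 0)
    (h2 : ∀ x, 1 < x → f x = 0) : ∃ B, 0 ≤ B ∧ ∀ x, |f x| ≤ B := by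
  obtain ⟨B, hB⟩ := (isCompact_Icc (a := (1/2:ℝ)) (b := 1)).exists_bound_of_continuousOn
    hf.continuous.continuousOn
  refine ⟨max B 0, le_max_right _ _, fun x => ?_⟩
  by_cases hx : x < 1/2
  · simp [h1 x hx]
  by_cases hx' : 1 < x
  · simp [h2 x hx']
  · exact le_max_of_le_left (hB x ⟨not_lt.1 hx, not_lt.1 hx'⟩)

lemma char_bounds {F : ℝ → ℝ} (hF : IsSmoothChar F) : ∃ B, 1 ≤ B ∧
    ∀ x, |deriv F x| ≤ B ∧ |deriv (deriv F) x| ≤ B ∧ |deriv (deriv (deriv F)) x| ≤ B := by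
  obtain ⟨hs, -, h0, h1, -⟩ := hF
  have o1 := deriv_out (f := F) (fun x hx => h0 x hx.le) (fun x hx => h1 x hx.le)
  have o2 := deriv_out o1.1 o1.2
  have o3 := deriv_out o2.1 o2.2
  have s1 := deriv_smooth hs
  have s2 := deriv_smooth s1
  have s3 := deriv_smooth s2
  obtain ⟨B1, p1, q1⟩ := out_bdd s1 o1.1 o1.2
  obtain ⟨B2, p2, q2⟩ := out_bdd s2 o2.1 o2.2
  obtain ⟨B3, p3, q3⟩ := out_bdd s3 o3.1 o3.2
  refine ⟨1 + B1 + B2 + B3, by linarith, fun x => ⟨?_, ?_, ?_⟩⟩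
  · linarith [q1 x]
  · linarith [q2 x]
  · linarith [q3 x]

lemma char_out {F : ℝ → ℝ} (hF : IsSmoothChar F) {x : ℝ} (hx : x < 1/2 ∨ 1 < x) :
    deriv F x = 0 ∧ deriv (deriv F) x = 0 ∧ deriv (deriv (deriv F)) x = 0 := by
  obtain ⟨hs, -, h0, h1, -⟩ := hF
  have o1 := deriv_out (f := F) (fun x hx => h0 x hx.le) (fun x hx => h1 x hx.le)
  have o2 := deriv_out o1.1 o1.2
  have o3 := deriv_out o2.1 o2.2
  rcases hx with hx | hx
  · exact ⟨o1.1 x hx, o2.1 x hx, o3.1 x hx⟩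
  · exact ⟨o1.2 x hx, o2.2 x hx, o3.2 x hx⟩

lemma char_sq {F : ℝ → ℝ} (hF : IsSmoothChar F) : IsSmoothChar (fun x => F x ^ 2) := by
  obtain ⟨hs, hm, h0, h1, hb⟩ := hF
  refine ⟨hs.pow 2, fun x y hxy => ?_, fun x hx => by simp [h0 x hx], fun x hx => by simp [h1 x hx],
    fun x => ⟨by positivity, ?_⟩⟩
  · have := hm hxy
    have := (hb x).1
    show F x ^ 2 ≤ F y ^ 2
    gcongr
  · have := hb x
    show F x ^ 2 ≤ 1
    nlinarith

/-- the truncated weight -/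
def wt (F : ℝ → ℝ) (α R : ℝ) (p : ℝ × ℝ) : ℝ :=
  F (p.2 * p.1 ^ (-α)) ^ 2 * (1 - F (p.2 / R))

lemma Dr_eq {u : ℝ × ℝ → ℝ} {t r d : ℝ} (hu : DifferentiableAt ℝ u (t, r))
    (h : HasDerivAt (fun y => u (t, y)) d r) : Dr u (t, r) = d := by
  have h2 : HasDerivAt (fun y : ℝ => ((t, y) : ℝ × ℝ)) (0, 1) r :=
    (hasDerivAt_const r t).prodMk (hasDerivAt_id r)
  have := hu.hasFDerivAt.comp_hasDerivAt r h2
  exact this.unique h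

lemma Dt_eq {u : ℝ × ℝ → ℝ} {t r d : ℝ} (hu : DifferentiableAt ℝ u (t, r))
    (h : HasDerivAt (fun y => u (y, r)) d t) : Dt u (t, r) = d := by
  have h2 : HasDerivAt (fun y : ℝ => ((y, r) : ℝ × ℝ)) (1, 0) t :=
    (hasDerivAt_id t).prodMk (hasDerivAt_const t r)
  have := hu.hasFDerivAt.comp_hasDerivAt t h2
  exact this.unique h

lemma Dr_congr {u v : ℝ × ℝ → ℝ} (h : ∀ p ∈ Om, u p = v p) {p : ℝ × ℝ} (hp : p ∈ Om) :
    Dr u p = Dr v p := by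
  have : u =ᶠ[𝓝 p] v := by
    filter_upwards [isOpen_Om.mem_nhds hp] with q hq using h q hq
  unfold Dr
  rw [this.fderiv_eq]

lemma smooth_rpow (α : ℝ) : ContDiffOn ℝ ∞ (fun p : ℝ × ℝ => p.1 ^ (-α)) Om := by
  intro p hp
  have : (0:ℝ) < p.1 := hp.1
  exact ((Real.contDiffAt_rpow_const_of_ne (this.ne')).comp p contDiffAt_fst).contDiffWithinAt

lemma smooth_lam {f : ℝ → ℝ} (hf : ContDiff ℝ ∞ f) (α : ℝ) :
    ContDiffOn ℝ ∞ (fun p : ℝ × ℝ => f (p.2 * p.1 ^ (-α))) Om :=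
  hf.comp_contDiffOn (contDiffOn_snd.mul (smooth_rpow α))

lemma smooth_div {f : ℝ → ℝ} (hf : ContDiff ℝ ∞ f) (R : ℝ) :
    ContDiffOn ℝ ∞ (fun p : ℝ × ℝ => f (p.2 / R)) Om :=
  hf.comp_contDiffOn (contDiffOn_snd.div_const R)

lemma wt_smooth {F : ℝ → ℝ} (hF : IsSmoothChar F) (α R : ℝ) : ContDiffOn ℝ ∞ (wt F α R) Om :=
  ((smooth_lam hF.1 α).pow 2).mul (contDiffOn_const.sub (smooth_div hF.1 R))

lemma hd_lam {f : ℝ → ℝ} (hf : ContDiff ℝ ∞ f) (s r : ℝ) :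
    HasDerivAt (fun y => f (y * s)) (deriv f (r * s) * s) r := by
  have h1 := (hf.differentiable (by simp) (r * s)).hasDerivAt
  have h2 : HasDerivAt (fun y : ℝ => y * s) s r := by simpa using (hasDerivAt_id r).mul_const s
  exact h1.comp r h2

lemma hd_div {f : ℝ → ℝ} (hf : ContDiff ℝ ∞ f) (R r : ℝ) :
    HasDerivAt (fun y => f (y / R)) (deriv f (r / R) / R) r := by
  simpa [div_eq_mul_inv] using hd_lam hf R⁻¹ r

lemma wt_formulas {F : ℝ → ℝ} (hF : IsSmoothChar F) (α R : ℝ) {t r : ℝ} (ht : 0 < t) :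
    let G := fun x => F x ^ 2
    let s := t ^ (-α)
    Dt (wt F α R) (t, r) = - (α * (r * s) * t⁻¹) * deriv G (r * s) * (1 - F (r / R)) ∧
    Dr (wt F α R) (t, r) = deriv G (r * s) * s * (1 - F (r / R)) - G (r * s) * (deriv F (r / R) / R)
    ∧ Dr (Dr (wt F α R)) (t, r) = deriv (deriv G) (r * s) * s ^ 2 * (1 - F (r / R))
      - 2 * (deriv G (r * s) * s * (deriv F (r / R) / R))
      - G (r * s) * (deriv (deriv F) (r / R) / R ^ 2)
    ∧ Dr (Dr (Dr (wt F α R))) (t, r) = deriv (deriv (deriv G)) (r * s) * s ^ 3 * (1 - F (r / R))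
      - 3 * (deriv (deriv G) (r * s) * s ^ 2 * (deriv F (r / R) / R))
      - 3 * (deriv G (r * s) * s * (deriv (deriv F) (r / R) / R ^ 2))
      - G (r * s) * (deriv (deriv (deriv F)) (r / R) / R ^ 3) := by
  intro G
  have hG : IsSmoothChar G := char_sq hF
  have G0 := hG.1
  have G1 := deriv_smooth G0
  have G2 := deriv_smooth G1
  have F0 := hF.1
  have F1 := deriv_smooth F0
  have F2 := deriv_smooth F1
  have hw := wt_smooth hF α R
  have hOm : ∀ {t r : ℝ}, 0 < t → ((t, r) : ℝ × ℝ) ∈ Om := fun h => ⟨h, trivial⟩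
  have e1 : ∀ p ∈ Om, Dr (wt F α R) p = (fun p : ℝ × ℝ =>
      deriv G (p.2 * p.1 ^ (-α)) * p.1 ^ (-α) * (1 - F (p.2 / R))
        - G (p.2 * p.1 ^ (-α)) * (deriv F (p.2 / R) / R)) p := by
    rintro ⟨t, r⟩ hp
    apply Dr_eq (diffAt_Om hw hp)
    have := (hd_lam G0 (t ^ (-α)) r).mul ((hd_div F0 R r).const_sub 1)
    refine (this.congr_deriv ?_)
    ring
  have e2 : ∀ p ∈ Om, Dr (Dr (wt F α R)) p = (fun p : ℝ × ℝ =>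
      deriv (deriv G) (p.2 * p.1 ^ (-α)) * (p.1 ^ (-α)) ^ 2 * (1 - F (p.2 / R))
      - 2 * (deriv G (p.2 * p.1 ^ (-α)) * p.1 ^ (-α) * (deriv F (p.2 / R) / R))
      - G (p.2 * p.1 ^ (-α)) * (deriv (deriv F) (p.2 / R) / R ^ 2)) p := by
    rintro ⟨t, r⟩ hp
    rw [Dr_congr e1 hp]
    refine Dr_eq (diffAt_Om ((Dr_smooth hw).congr fun p hp => (e1 p hp).symm) hp) ?_
    have := (((hd_lam G1 (t ^ (-α)) r).mul_const (t ^ (-α))).mul ((hd_div F0 R r).const_sub 1)).sub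
      ((hd_lam G0 (t ^ (-α)) r).mul ((hd_div F1 R r).div_const R))
    refine (this.congr_deriv ?_)
    ring
  refine ⟨?_, e1 _ (hOm ht), e2 _ (hOm ht), ?_⟩
  · apply Dt_eq (diffAt_Om hw (hOm ht))
    have h1 : HasDerivAt (fun y : ℝ => r * y ^ (-α)) (r * (-α * t ^ (-α - 1))) t :=
      (Real.hasDerivAt_rpow_const (Or.inl ht.ne')).const_mul r
    have h2 := ((G0.differentiable (by simp) (r * t ^ (-α))).hasDerivAt.comp t h1).mul_const
      (1 - F (r / R))
    refine (h2.congr_deriv ?_)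
    rw [Real.rpow_sub_one ht.ne']
    ring
  · rw [Dr_congr e2 (hOm ht)]
    refine Dr_eq (diffAt_Om ((Dr_smooth (Dr_smooth hw)).congr fun p hp => (e2 p hp).symm) (hOm ht)) ?_
    have := ((((hd_lam G2 (t ^ (-α)) r).mul_const ((t ^ (-α)) ^ 2)).mul
      ((hd_div F0 R r).const_sub 1)).sub
      ((((hd_lam G1 (t ^ (-α)) r).mul_const (t ^ (-α))).mul ((hd_div F1 R r).div_const R)).const_mul
        2)).sub
      ((hd_lam G0 (t ^ (-α)) r).mul ((hd_div F2 R r).div_const (R ^ 2)))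
    refine (this.congr_deriv ?_)
    ring

lemma amgm {s m q x y : ℝ} (hs : 0 < s) (h : m ^ 2 ≤ s * q) : m * (x * y) ≤ s * x ^ 2 + q * y ^ 2 := by
  have h1 : s * (m * (x * y)) ≤ s * (s * x ^ 2 + q * y ^ 2) := by
    have : m ^ 2 * y ^ 2 ≤ s * q * y ^ 2 := by gcongr
    nlinarith [sq_nonneg (s * x - m * y), sq_nonneg (s * x), sq_nonneg (m * y)]
  exact le_of_mul_le_mul_left h1 hs

set_option maxHeartbeats 1000000 in
lemma E_alg {a b x y n F0 F1 X f1 s m q w3 c B Ri : ℝ} (hs : 0 < s) (hs1 : s ≤ 1)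
    (hm : F1 ≠ 0 → m ^ 2 ≤ s * q) (hq : 0 ≤ q)
    (hF0 : 0 ≤ F0) (hF0' : F0 ≤ 1) (hF1 : 0 ≤ F1) (hF1' : F1 ≤ B) (hX : 0 ≤ X) (hX' : X ≤ 1)
    (hf1 : 0 ≤ f1) (hf1' : f1 ≤ B) (hRi : 0 ≤ Ri) (hRi1 : Ri ≤ 1)
    (hw3 : |w3| ≤ B * s ^ 3 + 7 * B ^ 2 * Ri) (hc : |F0 * n| ≤ c) (hB : 1 ≤ B) :
    -((2 * B * q + (B * s ^ 3 + 7 * B ^ 2 * Ri) / 2 + 2 * B * Ri + 3 * B * c + c)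
      * (a ^ 2 + b ^ 2 + (x ^ 2 + y ^ 2))) ≤
    -m * (2 * F0 * F1) * X * (a * y - b * x)
      + 2 * (2 * F0 * F1 * s * X - F0 ^ 2 * (f1 * Ri)) * (x ^ 2 + y ^ 2)
      - 1 / 2 * w3 * (a ^ 2 + b ^ 2)
      + (2 * F0 * F1 * s * X - F0 ^ 2 * (f1 * Ri)) * (a * (n * a) + b * (n * b))
      + 2 * (F0 ^ 2 * X) * (x * (n * a) + y * (n * b)) := by
  have hQ1 : 0 ≤ a ^ 2 + b ^ 2 := by positivity
  have hQ2 : 0 ≤ x ^ 2 + y ^ 2 := by positivity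
  have hc0 : 0 ≤ c := (abs_nonneg _).trans hc
  obtain ⟨hc1, hc2⟩ := abs_le.1 hc
  obtain ⟨hw1, hw2⟩ := abs_le.1 hw3
  -- first piece
  have p1 : -(2 * B * q * (a ^ 2 + b ^ 2)) ≤ -m * (2 * F0 * F1) * X * (a * y - b * x)
      + 2 * (2 * F0 * F1 * s * X) * (x ^ 2 + y ^ 2) := by
    by_cases h0 : F1 = 0
    · simp [h0]; positivity
    have i1 := amgm (x := y) (y := a) hs (hm h0)
    have i2 := amgm (x := x) (y := -b) hs (hm h0)
    have i3 : -(q * (a ^ 2 + b ^ 2)) ≤ -m * (a * y - b * x) + 2 * s * (x ^ 2 + y ^ 2) := by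
      have : 0 ≤ s * (x ^ 2 + y ^ 2) := by positivity
      linarith
    have hg0 : 0 ≤ 2 * F0 * F1 * X := by positivity
    have hg1 : 2 * F0 * F1 * X ≤ 2 * B := by
      calc 2 * F0 * F1 * X ≤ 2 * 1 * B * 1 := by gcongr
        _ = 2 * B := by ring
    have i4 := mul_le_mul_of_nonneg_left i3 hg0
    have i5 := mul_le_mul_of_nonneg_right hg1 (mul_nonneg hq hQ1)
    linarith
  have p2 : -(2 * B * Ri * (x ^ 2 + y ^ 2)) ≤ 2 * (- (F0 ^ 2 * (f1 * Ri))) * (x ^ 2 + y ^ 2) := by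
    have : F0 ^ 2 * (f1 * Ri) ≤ 1 ^ 2 * (B * Ri) := by gcongr
    have := mul_le_mul_of_nonneg_right this hQ2
    linarith
  have p3 : -((B * s ^ 3 + 7 * B ^ 2 * Ri) / 2 * (a ^ 2 + b ^ 2)) ≤ - 1 / 2 * w3 * (a ^ 2 + b ^ 2) := by
    have := mul_le_mul_of_nonneg_right hw2 hQ1
    linarith
  have p4 : -(3 * B * c * (a ^ 2 + b ^ 2)) ≤
      (2 * F0 * F1 * s * X - F0 ^ 2 * (f1 * Ri)) * (a * (n * a) + b * (n * b)) := by
    have e : (2 * F0 * F1 * s * X - F0 ^ 2 * (f1 * Ri)) * (a * (n * a) + b * (n * b))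
      = ((F0 * n) * (2 * F1 * s * X - F0 * (f1 * Ri))) * (a ^ 2 + b ^ 2) := by ring
    have u1 : 2 * F1 * s * X ≤ 2 * B * 1 * 1 := by gcongr
    have u2 : 0 ≤ 2 * F1 * s * X := by positivity
    have u3 : F0 * (f1 * Ri) ≤ 1 * (B * 1) := by gcongr
    have u4 : 0 ≤ F0 * (f1 * Ri) := by positivity
    have u5 : |2 * F1 * s * X - F0 * (f1 * Ri)| ≤ 3 * B := by
      rw [abs_le]; constructor <;> linarith
    have u6 : |(F0 * n) * (2 * F1 * s * X - F0 * (f1 * Ri))| ≤ c * (3 * B) := by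
      rw [abs_mul]; gcongr
    have u7 := mul_le_mul_of_nonneg_right (abs_le.1 u6).1 hQ1
    rw [e]; linarith
  have p5 : -(c * (a ^ 2 + b ^ 2 + (x ^ 2 + y ^ 2))) ≤ 2 * (F0 ^ 2 * X) * (x * (n * a) + y * (n * b)) := by
    have e : 2 * (F0 ^ 2 * X) * (x * (n * a) + y * (n * b)) =
      ((F0 * n) * (F0 * X)) * (2 * (x * a + y * b)) := by ring
    have u1 : |F0 * X| ≤ 1 := by
      rw [abs_of_nonneg (by positivity)]
      calc F0 * X ≤ 1 * 1 := by gcongr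
        _ = 1 := by ring
    have u2 : |2 * (x * a + y * b)| ≤ a ^ 2 + b ^ 2 + (x ^ 2 + y ^ 2) := by
      rw [abs_le]
      constructor
      · linarith [sq_nonneg (x + a), sq_nonneg (y + b), add_sq x a, add_sq y b]
      · linarith [sq_nonneg (x - a), sq_nonneg (y - b), sub_sq x a, sub_sq y b]
    have u3 : |((F0 * n) * (F0 * X)) * (2 * (x * a + y * b))| ≤
        (c * 1) * (a ^ 2 + b ^ 2 + (x ^ 2 + y ^ 2)) := by
      rw [abs_mul, abs_mul]; gcongr
    rw [e]
    linarith [(abs_le.1 u3).1]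
  have k1 : 0 ≤ 2 * B * q * (x ^ 2 + y ^ 2) := by positivity
  have k2 : 0 ≤ (B * s ^ 3 + 7 * B ^ 2 * Ri) / 2 * (x ^ 2 + y ^ 2) := by positivity
  have k3 : 0 ≤ 2 * B * Ri * (a ^ 2 + b ^ 2) := by positivity
  have k4 : 0 ≤ 3 * B * c * (x ^ 2 + y ^ 2) := by positivity
  linarith

set_option maxHeartbeats 1000000 in
lemma E_lower {F : ℝ → ℝ} (hF : IsSmoothChar F) {α β₀ C : ℝ} (hα : α ∈ Set.Ioo (1 / 3 : ℝ) 1)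
    (hC : 0 ≤ C) {p : ℝ} (hp1 : p ≤ 2 - α) (hp2 : p ≤ 3 * α) (hp3 : p ≤ β₀) :
    ∃ D, 0 ≤ D ∧ ∀ (R : ℝ), 1 ≤ R → ∀ (a b : ℝ × ℝ → ℝ) (t r n : ℝ), 1 ≤ t → 0 ≤ r →
      Dr (Dr a) (t, r) - Dt b (t, r) = n * a (t, r) →
      Dr (Dr b) (t, r) + Dt a (t, r) = n * b (t, r) →
      |F (r * t ^ (-α)) * n| ≤ C * t ^ (-β₀) →
      - ((D * (t ^ (-p) + 1 / R)) * Qen a b (t, r)) ≤ Een a b (wt F α R) (t, r) := by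
  obtain ⟨B1, hB1, hF'⟩ := char_bounds hF
  obtain ⟨B2, hB2, hG'⟩ := char_bounds (char_sq hF)
  obtain ⟨B, hB, hBB1, hBB2⟩ : ∃ B, 1 ≤ B ∧ B1 ≤ B ∧ B2 ≤ B :=
    ⟨B1 + B2, by linarith, by linarith, by linarith⟩
  refine ⟨3 * B + 8 * B ^ 2 + 2 * B + 3 * B * C + C, by positivity, ?_⟩
  intro R hR a b t r n ht hr e1 e2 hn
  have ht0 : 0 < t := by linarith
  have hR0 : 0 < R := by linarith
  obtain ⟨f1, f2, f3, f4⟩ := wt_formulas hF α R (r := r) ht0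
  have hGd : deriv (fun x => F x ^ 2) (r * t ^ (-α)) =
      2 * F (r * t ^ (-α)) * deriv F (r * t ^ (-α)) := by
    have := ((hF.1.differentiable (by simp) (r * t ^ (-α))).hasDerivAt.pow 2).deriv
    exact this.trans (by simp)
  set s := t ^ (-α) with hs
  have hs0 : 0 < s := Real.rpow_pos_of_pos ht0 _
  have hs1 : s ≤ 1 := Real.rpow_le_one_of_one_le_of_nonpos ht (by linarith [hα.1])
  have hRi : 0 ≤ R⁻¹ := by positivity
  have hRi1 : R⁻¹ ≤ 1 := inv_le_one_of_one_le₀ hR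
  obtain ⟨hsm, hmono, h0, h1, hb⟩ := hF
  have hd : ∀ x, 0 ≤ deriv F x := fun x => hmono.deriv_nonneg
  have hq : t ^ (α - 2) ≤ t ^ (-p) := Real.rpow_le_rpow_of_exponent_le ht (by linarith)
  have hs3 : s ^ 3 ≤ t ^ (-p) := by
    rw [hs, ← Real.rpow_natCast, ← Real.rpow_mul ht0.le]
    exact Real.rpow_le_rpow_of_exponent_le ht (by push_cast; linarith)
  have hcc : t ^ (-β₀) ≤ t ^ (-p) := Real.rpow_le_rpow_of_exponent_le ht (by linarith)
  have hτ : 0 < t ^ (-p) := Real.rpow_pos_of_pos ht0 _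
  have hw3 : |Dr (Dr (Dr (wt F α R))) (t, r)| ≤ B * s ^ 3 + 7 * B ^ 2 * R⁻¹ := by
    rw [f4]
    have g1 := (hG' (r * s)).1.trans hBB2
    have g2 := (hG' (r * s)).2.1.trans hBB2
    have g3 := (hG' (r * s)).2.2.trans hBB2
    have k1 := (hF' (r / R)).1.trans hBB1
    have k2 := (hF' (r / R)).2.1.trans hBB1
    have k3 := (hF' (r / R)).2.2.trans hBB1
    have hG0 : |F (r * s) ^ 2| ≤ 1 := by
      rw [abs_of_nonneg (by positivity)]
      exact pow_le_one₀ (hb _).1 (hb _).2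
    have hX : |1 - F (r / R)| ≤ 1 := by
      rw [abs_le]; constructor <;> linarith [(hb (r / R)).1, (hb (r / R)).2]
    have hs_abs : |s| = s := abs_of_pos hs0
    have hR_abs : |R⁻¹| = R⁻¹ := abs_of_nonneg hRi
    have t1 : |deriv (deriv (deriv (fun x => F x ^ 2))) (r * s) * s ^ 3 * (1 - F (r / R))| ≤
        B * s ^ 3 * 1 := by
      rw [abs_mul, abs_mul, abs_pow, hs_abs]; gcongr
    have t2 : |3 * (deriv (deriv (fun x => F x ^ 2)) (r * s) * s ^ 2 * (deriv F (r / R) / R))| ≤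
        3 * (B * 1 ^ 2 * (B * R⁻¹)) := by
      rw [div_eq_mul_inv, abs_mul, abs_mul, abs_mul, abs_mul, abs_pow, hs_abs, hR_abs,
        abs_of_pos (by norm_num : (0:ℝ) < 3)]
      gcongr
    have t3 : |3 * (deriv (fun x => F x ^ 2) (r * s) * s * (deriv (deriv F) (r / R) / R ^ 2))| ≤
        3 * (B * 1 * (B * (R⁻¹ * 1))) := by
      rw [div_eq_mul_inv, ← inv_pow, pow_two, abs_mul, abs_mul, abs_mul, abs_mul, abs_mul, hs_abs,
        hR_abs, abs_of_pos (by norm_num : (0:ℝ) < 3)]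
      gcongr
    have t4 : |F (r * s) ^ 2 * (deriv (deriv (deriv F)) (r / R) / R ^ 3)| ≤
        1 * (B * (1 ^ 2 * R⁻¹)) := by
      rw [div_eq_mul_inv, ← inv_pow, pow_succ R⁻¹, abs_mul, abs_mul, abs_mul, abs_pow R⁻¹, hR_abs]
      gcongr
    have hBB : B * R⁻¹ ≤ B ^ 2 * R⁻¹ := by
      have : B ≤ B ^ 2 := by nlinarith
      gcongr
    rw [abs_le] at t1 t2 t3 t4 ⊢
    obtain ⟨t1, t1'⟩ := t1
    obtain ⟨t2, t2'⟩ := t2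
    obtain ⟨t3, t3'⟩ := t3
    obtain ⟨t4, t4'⟩ := t4
    clear hG' hF' hb hd h0 h1 f1 f2 f3 f4 hn e1 e2
    constructor <;> linarith
  have hm : deriv F (r * s) ≠ 0 → (α * (r * s) * t⁻¹) ^ 2 ≤ s * t ^ (α - 2) := by
    intro hne
    have hl : r * s ≤ 1 := by
      by_contra hcon
      exact hne (char_out ⟨hsm, hmono, h0, h1, hb⟩ (Or.inr (not_le.1 hcon))).1
    have hl0 : 0 ≤ r * s := by positivity
    have e : s * t ^ (α - 2) = (t⁻¹) ^ 2 := by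
      rw [hs, ← Real.rpow_add ht0, show -α + (α - 2) = -(2:ℕ) by push_cast; ring,
        Real.rpow_neg ht0.le, Real.rpow_natCast, inv_pow]
    rw [e]
    have h01 : 0 ≤ α := by linarith [hα.1]
    have : α * (r * s) * t⁻¹ ≤ 1 * 1 * t⁻¹ := by
      have := hα.2.le
      gcongr
    have h3 : 0 ≤ α * (r * s) * t⁻¹ := by positivity
    calc (α * (r * s) * t⁻¹) ^ 2 ≤ (1 * 1 * t⁻¹) ^ 2 := by gcongr
      _ = _ := by ring
  have main := E_alg (a := a (t, r)) (b := b (t, r)) (x := Dr a (t, r)) (y := Dr b (t, r))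
    (n := n) (F0 := F (r * s)) (F1 := deriv F (r * s)) (X := 1 - F (r / R)) (f1 := deriv F (r / R))
    (m := α * (r * s) * t⁻¹) (q := t ^ (α - 2)) (Ri := R⁻¹)
    (c := C * t ^ (-β₀)) (B := B) (w3 := Dr (Dr (Dr (wt F α R))) (t, r))
    hs0 hs1 hm (Real.rpow_nonneg ht0.le _) (hb _).1 (hb _).2 (hd _)
    ((le_abs_self _).trans ((hF' _).1.trans hBB1)) (by linarith [(hb (r / R)).2])
    (by linarith [(hb (r / R)).1]) (hd _)
    ((le_abs_self _).trans ((hF' _).1.trans hBB1)) hRi hRi1 hw3 hn hB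
  have hQ : 0 ≤ Qen a b (t, r) := by unfold Qen; positivity
  have hcoef : 2 * B * t ^ (α - 2) + (B * s ^ 3 + 7 * B ^ 2 * R⁻¹) / 2 + 2 * B * R⁻¹
      + 3 * B * (C * t ^ (-β₀)) + C * t ^ (-β₀) ≤
      (3 * B + 8 * B ^ 2 + 2 * B + 3 * B * C + C) * (t ^ (-p) + 1 / R) := by
    rw [one_div]
    have i1 : B * t ^ (α - 2) ≤ B * t ^ (-p) := by gcongr
    have i2 : B * s ^ 3 ≤ B * t ^ (-p) := by gcongr
    have i3 : C * t ^ (-β₀) ≤ C * t ^ (-p) := by gcongr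
    have i4 : B * (C * t ^ (-β₀)) ≤ B * (C * t ^ (-p)) := by gcongr
    have j1 : 0 ≤ B * R⁻¹ := by positivity
    have j2 : 0 ≤ B ^ 2 * R⁻¹ := by positivity
    have j3 : 0 ≤ C * R⁻¹ := by positivity
    have j4 : 0 ≤ B * C * R⁻¹ := by positivity
    have j5 : 0 ≤ B * t ^ (-p) := by positivity
    have j6 : 0 ≤ B ^ 2 * t ^ (-p) := by positivity
    linarith
  have := mul_le_mul_of_nonneg_right hcoef hQ
  refine (neg_le_neg this).trans ?_
  refine main.trans (le_of_eq ?_)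
  unfold Een
  rw [f1, f2, hGd, e1, e2]
  simp only [wt]
  rw [← hs]
  ring

lemma Qen_nonneg (a b : ℝ × ℝ → ℝ) (p : ℝ × ℝ) : 0 ≤ Qen a b p := by unfold Qen; positivity

lemma slice_cont {u : ℝ × ℝ → ℝ} (hu : ContDiffOn ℝ ∞ u Om) {t : ℝ} (ht : 0 < t) :
    Continuous (fun r => u (t, r)) := by
  have := hu.continuousOn.comp (f := fun r : ℝ => ((t, r) : ℝ × ℝ)) (s := Set.univ)
    (by fun_prop) (fun r _ => ⟨ht, trivial⟩)
  exact continuousOn_univ.1 this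

lemma J_le_Q (a b : ℝ × ℝ → ℝ) (p : ℝ × ℝ) : |a p * Dr b p - b p * Dr a p| ≤ Qen a b p := by
  unfold Qen
  rw [abs_le]
  constructor
  · nlinarith [sq_nonneg (a p + Dr b p), sq_nonneg (b p - Dr a p), sq_nonneg (a p), sq_nonneg (b p),
      sq_nonneg (Dr a p), sq_nonneg (Dr b p)]
  · nlinarith [sq_nonneg (a p - Dr b p), sq_nonneg (b p + Dr a p), sq_nonneg (a p), sq_nonneg (b p),
      sq_nonneg (Dr a p), sq_nonneg (Dr b p)]

lemma conv_of_almost_mono {Ψ : ℝ → ℝ} {T D p M : ℝ} (hT : 1 ≤ T) (hp : 1 < p) (hD : 0 ≤ D)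
    (h : ∀ t₁ t₂, T ≤ t₁ → t₁ ≤ t₂ → - (D * ∫ t in t₁..t₂, t ^ (-p)) ≤ Ψ t₂ - Ψ t₁)
    (hM : ∀ t, T ≤ t → Ψ t ≤ M) : ∃ L, Tendsto Ψ atTop (𝓝 L) := by
  let c := D / (p - 1)
  have hc : 0 ≤ c := div_nonneg hD (by linarith)
  let Φ : ℝ → ℝ := fun t => Ψ (max t T) - c * (max t T) ^ (1 - p)
  have hmono : Monotone Φ := by
    intro x y hxy
    have hxy' : max x T ≤ max y T := max_le_max hxy le_rfl
    have hx0 : 0 < max x T := by linarith [le_max_right x T]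
    have := h (max x T) (max y T) (le_max_right _ _) hxy'
    rw [integral_rpow (Or.inr ⟨by linarith, by
      rw [Set.uIcc_of_le hxy']; exact fun h => absurd h.1 (not_le.2 hx0)⟩)] at this
    have e : D * (((max y T) ^ (-p + 1) - (max x T) ^ (-p + 1)) / (-p + 1)) =
        - (c * (max y T) ^ (1 - p) - c * (max x T) ^ (1 - p)) := by
      have h1 : p - 1 ≠ 0 := by linarith
      have h2 : -p + 1 ≠ 0 := by intro h; apply h1; linarith
      simp only [c]
      rw [show -p + 1 = -(p - 1) by ring, show 1 - p = -(p - 1) by ring]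
      field_simp
    rw [e] at this
    simp only [Φ]
    linarith
  have hbdd : BddAbove (Set.range Φ) := by
    refine ⟨M, ?_⟩
    rintro _ ⟨t, rfl⟩
    have h1 := hM (max t T) (le_max_right _ _)
    have h2 : 0 ≤ c * (max t T) ^ (1 - p) :=
      mul_nonneg hc (Real.rpow_nonneg (by linarith [le_max_right t T]) _)
    simp only [Φ]; linarith
  have hlim := tendsto_atTop_ciSup hmono hbdd
  have hz : Tendsto (fun t : ℝ => c * t ^ (1 - p)) atTop (𝓝 (c * 0)) := by
    have := tendsto_rpow_neg_atTop (y := p - 1) (by linarith)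
    simp only [neg_sub] at this
    exact this.const_mul c
  refine ⟨_, (hlim.add hz).congr' ?_⟩
  filter_upwards [eventually_ge_atTop T] with t ht
  simp [Φ, max_eq_left ht]

theorem oneD {a b : ℝ × ℝ → ℝ} (ha : ContDiffOn ℝ ∞ a Om) (hb : ContDiffOn ℝ ∞ b Om)
    {F : ℝ → ℝ} (hF : IsSmoothChar F) {α β₀ C : ℝ} (hα : α ∈ Set.Ioo (1 / 3 : ℝ) 1)
    (hC : 0 ≤ C) (hβ : 1 < β₀) (n : ℝ → ℝ → ℝ) {T : ℝ} (hT : 1 ≤ T)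
    (hTα : ∀ t, T ≤ t → 4 ≤ t ^ α)
    (e1 : ∀ t, T ≤ t → ∀ r, 1 ≤ r → Dr (Dr a) (t, r) - Dt b (t, r) = n t r * a (t, r))
    (e2 : ∀ t, T ≤ t → ∀ r, 1 ≤ r → Dr (Dr b) (t, r) + Dt a (t, r) = n t r * b (t, r))
    (hn : ∀ t, T ≤ t → ∀ r, 1 ≤ r → |F (r * t ^ (-α)) * n t r| ≤ C * t ^ (-β₀))
    (hQi : ∀ t, T ≤ t → IntegrableOn (fun r => Qen a b (t, r)) (Set.Ioi 1))
    (C1 : ℝ) (hQ : ∀ t, T ≤ t → ∫ r in Set.Ioi (1:ℝ), Qen a b (t, r) ≤ C1) :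
    ∃ L, Tendsto (fun t => ∫ r in Set.Ioi (1:ℝ), F (r * t ^ (-α)) ^ 2 *
      (a (t, r) * Dr b (t, r) - b (t, r) * Dr a (t, r))) atTop (𝓝 L) := by
  obtain ⟨p, hp, hp1, hp2, hp3⟩ : ∃ p, 1 < p ∧ p ≤ 2 - α ∧ p ≤ 3 * α ∧ p ≤ β₀ := by
    refine ⟨min (2 - α) (min (3 * α) β₀), ?_, min_le_left _ _,
      (min_le_right _ _).trans (min_le_left _ _), (min_le_right _ _).trans (min_le_right _ _)⟩
    have := hα.1
    have := hα.2
    refine lt_min (by linarith) (lt_min (by linarith) hβ)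
  obtain ⟨D, hD, hE⟩ := E_lower hF hα hC hp1 hp2 hp3
  have hbF := hF.2.2.2.2
  have hC1 : 0 ≤ C1 := (integral_nonneg (fun r => Qen_nonneg a b (T, r))).trans (hQ T le_rfl)
  set Ψ : ℝ → ℝ := fun t => ∫ r in Set.Ioi (1:ℝ), F (r * t ^ (-α)) ^ 2 *
      (a (t, r) * Dr b (t, r) - b (t, r) * Dr a (t, r)) with hΨ
  have hF2 : ∀ x, |F x ^ 2| ≤ 1 := by
    intro x
    rw [abs_of_nonneg (by positivity)]
    exact pow_le_one₀ (hbF x).1 (hbF x).2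
  -- truncated functionals
  have hR_eq : ∀ R : ℝ, 1 ≤ R → ∀ t, T ≤ t →
      ∫ r in (1:ℝ)..(2 * R), Jfun a b (wt F α R) (t, r) =
        ∫ r in Set.Ioi (1:ℝ), Jfun a b (wt F α R) (t, r) := by
    intro R hR t ht
    rw [intervalIntegral.integral_of_le (by linarith)]
    symm
    apply setIntegral_eq_of_subset_of_forall_sdiff_eq_zero measurableSet_Ioi
      Set.Ioc_subset_Ioi_self
    rintro r ⟨hr1, hr2⟩
    have hr : 2 * R < r := by
      by_contra hcon
      exact hr2 ⟨hr1, not_lt.1 hcon⟩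
    have : F (r / R) = 1 := hF.2.2.2.1 _ (by rw [le_div_iff₀ (by linarith)]; linarith)
    simp [Jfun, wt, this]
  have hlimR : ∀ t, T ≤ t → Tendsto (fun k : ℕ => ∫ r in Set.Ioi (1:ℝ),
      Jfun a b (wt F α ((k:ℝ) + 1)) (t, r)) atTop (𝓝 (Ψ t)) := by
    intro t ht
    have ht0 : 0 < t := by linarith
    apply tendsto_integral_of_dominated_convergence (fun r => Qen a b (t, r))
    · intro k
      exact (slice_cont (Jfun_smooth ha hb (wt_smooth hF α _)) ht0).aestronglyMeasurable
    · exact hQi t ht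
    · intro k
      refine Eventually.of_forall fun r => ?_
      simp only [Jfun, wt, Pi.mul_apply, Pi.sub_apply, Real.norm_eq_abs]
      rw [abs_mul, abs_mul]
      have hX : |1 - F (r / ((k:ℝ) + 1))| ≤ 1 := by
        rw [abs_le]
        constructor <;> linarith [(hbF (r / ((k:ℝ) + 1))).1, (hbF (r / ((k:ℝ) + 1))).2]
      calc _ ≤ 1 * 1 * Qen a b (t, r) := by
            gcongr
            · exact hF2 _
            · exact J_le_Q a b _
        _ = _ := by ring
    · refine Eventually.of_forall fun r => ?_
      apply tendsto_const_nhds.congr'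
      have : Tendsto (fun k : ℕ => (k:ℝ) + 1) atTop atTop :=
        tendsto_atTop_add_const_right _ _ tendsto_natCast_atTop_atTop
      filter_upwards [this.eventually_ge_atTop (2 * |r|)] with k hk
      have hk0 : (0:ℝ) < (k:ℝ) + 1 := by positivity
      have : F (r / ((k:ℝ) + 1)) = 0 := by
        apply hF.2.2.1
        rw [div_le_iff₀ hk0]
        linarith [le_abs_self r]
      simp [Jfun, wt, this]
  -- boundary values
  have hlow : ∀ t, T ≤ t → ∀ r, r ≤ 1 → r * t ^ (-α) < 1 / 2 := by
    intro t ht r hr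
    have h4 := hTα t ht
    rw [Real.rpow_neg (by linarith), ← div_eq_mul_inv, div_lt_iff₀ (by linarith)]
    linarith
  have hineqR : ∀ R : ℝ, 1 ≤ R → ∀ t₁ t₂, T ≤ t₁ → t₁ ≤ t₂ →
      -(C1 * ∫ t in t₁..t₂, D * (t ^ (-p) + 1 / R)) ≤
      (∫ r in Set.Ioi (1:ℝ), Jfun a b (wt F α R) (t₂, r)) -
        ∫ r in Set.Ioi (1:ℝ), Jfun a b (wt F α R) (t₁, r) := by
    intro R hR t₁ t₂ h1 h12
    rw [← hR_eq R hR t₁ h1, ← hR_eq R hR t₂ (h1.trans h12)]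
    have hR0 : 0 < R := by linarith
    refine core_ineq ha hb (wt_smooth hF α R) (by linarith) h12 (by linarith) ?_ ?_
      (fun t => D * (t ^ (-p) + 1 / R)) ?_ ?_ ?_ C1 ?_
    · intro t ht
      obtain ⟨-, f2, f3, -⟩ := wt_formulas hF α R (r := 1) (show 0 < t by linarith [ht.1])
      have hl := hlow t (h1.trans ht.1) 1 le_rfl
      have g := char_out (char_sq hF) (Or.inl hl)
      have hF0 := hF.2.2.1 _ hl.le
      rw [f2, f3, g.1, g.2.1]
      simp only [hF0, wt]
      simp
    · intro t ht
      obtain ⟨-, f2, f3, -⟩ := wt_formulas hF α R (r := 2 * R) (show 0 < t by linarith [ht.1])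
      have hl : 1 < 2 * R / R := by rw [lt_div_iff₀ hR0]; linarith
      have g := char_out hF (Or.inr hl)
      have hF0 := hF.2.2.2.1 _ hl.le
      rw [f2, f3, g.1, g.2.1]
      simp only [hF0, wt]
      simp
    · apply ContinuousOn.mul continuousOn_const
      apply ContinuousOn.add _ continuousOn_const
      intro t ht
      exact (Real.continuousAt_rpow_const _ _
        (Or.inl (by linarith [ht.1] : 0 < t).ne')).continuousWithinAt
    · intro t ht
      have : 0 ≤ t ^ (-p) := Real.rpow_nonneg (by linarith [ht.1]) _
      show 0 ≤ D * (t ^ (-p) + 1 / R)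
      positivity
    · intro t ht r hr
      have ht' := h1.trans ht.1
      exact hE R hR a b t r (n t r) (hT.trans ht') (by linarith [hr.1]) (e1 t ht' r hr.1)
        (e2 t ht' r hr.1) (hn t ht' r hr.1)
    · intro t ht
      have ht' := h1.trans ht.1
      refine le_trans ?_ (hQ t ht')
      rw [intervalIntegral.integral_of_le (by linarith)]
      apply setIntegral_mono_set (hQi t ht')
      · exact Eventually.of_forall fun r => Qen_nonneg a b _
      · exact (Set.Ioc_subset_Ioi_self).eventuallyLE
  have hineq : ∀ t₁ t₂, T ≤ t₁ → t₁ ≤ t₂ →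
      -((C1 * D) * ∫ t in t₁..t₂, t ^ (-p)) ≤ Ψ t₂ - Ψ t₁ := by
    intro t₁ t₂ h1 h12
    have hL := (hlimR t₂ (h1.trans h12)).sub (hlimR t₁ h1)
    have hint : IntervalIntegrable (fun t : ℝ => t ^ (-p)) volume t₁ t₂ := by
      apply ContinuousOn.intervalIntegrable
      rw [Set.uIcc_of_le h12]
      intro t ht
      exact (Real.continuousAt_rpow_const _ _
        (Or.inl (by linarith [ht.1] : 0 < t).ne')).continuousWithinAt
    have hI : ∀ k : ℕ, -(C1 * ∫ t in t₁..t₂, D * (t ^ (-p) + 1 / ((k:ℝ) + 1))) =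
        -((C1 * D) * ∫ t in t₁..t₂, t ^ (-p)) - C1 * D * (t₂ - t₁) * (1 / ((k:ℝ) + 1)) := by
      intro k
      rw [intervalIntegral.integral_const_mul, intervalIntegral.integral_add hint (by simp)]
      simp
      ring
    have hl2 : Tendsto (fun k : ℕ => -(C1 * ∫ t in t₁..t₂, D * (t ^ (-p) + 1 / ((k:ℝ) + 1))))
        atTop (𝓝 (-((C1 * D) * ∫ t in t₁..t₂, t ^ (-p)) - C1 * D * (t₂ - t₁) * 0)) := by
      simp only [hI]
      exact tendsto_const_nhds.sub (tendsto_one_div_add_atTop_nhds_zero_nat.const_mul _)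
    rw [mul_zero, sub_zero] at hl2
    refine le_of_tendsto_of_tendsto' hl2 hL fun k => ?_
    exact hineqR _ (by linarith [(Nat.cast_nonneg k : (0:ℝ) ≤ k)]) t₁ t₂ h1 h12
  refine conv_of_almost_mono hT hp (mul_nonneg hC1 hD) hineq (M := C1) ?_
  intro t ht
  have ht0 : 0 < t := by linarith
  refine le_trans ?_ (hQ t ht)
  have hbd : ∀ r, |F (r * t ^ (-α)) ^ 2 *
      (a (t, r) * Dr b (t, r) - b (t, r) * Dr a (t, r))| ≤ Qen a b (t, r) := by
    intro r
    rw [abs_mul]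
    calc _ ≤ 1 * Qen a b (t, r) := by
            gcongr
            · exact hF2 _
            · exact J_le_Q a b _
        _ = _ := by ring
  refine integral_mono ?_ (hQi t ht) (fun r => (le_abs_self _).trans (hbd r))
  refine (hQi t ht).mono' ?_ (Eventually.of_forall hbd)
  have h1 := slice_cont (smooth_lam hF.1 α) ht0
  have h2 := slice_cont ha ht0
  have h3 := slice_cont hb ht0
  have h4 := slice_cont (Dr_smooth ha) ht0
  have h5 := slice_cont (Dr_smooth hb) ht0
  exact ((h1.pow 2).mul ((h2.mul h5).sub (h3.mul h4))).aestronglyMeasurable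

lemma hasFDerivAt_norm3 {x : R3} (hx : x ≠ 0) :
    HasFDerivAt (fun y : R3 => ‖y‖) (‖x‖⁻¹ • innerSL ℝ x) x := by
  have hx' : ‖x‖ ≠ 0 := norm_ne_zero_iff.2 hx
  have h := (hasStrictFDerivAt_norm_sq x).hasFDerivAt.sqrt (by positivity)
  simp only [Real.sqrt_sq (norm_nonneg _)] at h
  refine h.congr_fderiv ?_
  ext v
  simp
  field_simp

lemma fderiv_radial {ψ : R3 → ℂ} {U : ℝ → ℂ} {x : R3} (hx : x ≠ 0)
    (hψ : ∀ᶠ y in 𝓝 x, ψ y = U ‖y‖) {U' : ℂ} (hU : HasDerivAt U U' ‖x‖) (v : R3) :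
    fderiv ℝ ψ x v = ((‖x‖⁻¹ * inner ℝ x v : ℝ) : ℂ) * U' := by
  have h1 : HasFDerivAt (fun y : R3 => U ‖y‖) _ x :=
    hU.hasFDerivAt.comp x (hasFDerivAt_norm3 hx)
  have h2 : ψ =ᶠ[𝓝 x] fun y => U ‖y‖ := hψ
  rw [h2.fderiv_eq, h1.fderiv]
  simp [mul_assoc]

/-- the first coordinate vector -/
def e0 : R3 := EuclideanSpace.single 0 1

lemma norm_e0 : ‖e0‖ = 1 := by simp [e0]
lemma norm_smul_e0 (r : ℝ) : ‖r • e0‖ = |r| := by simp [norm_smul, norm_e0]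

section radial
variable {ψ : R3 → ℂ}

lemma radial_eq (hr : ∀ x y : R3, ‖x‖ = ‖y‖ → ψ x = ψ y) (x : R3) : ψ x = ψ (‖x‖ • e0) :=
  hr _ _ (by simp [norm_smul_e0])

lemma line_smooth (hs : ContDiff ℝ ∞ ψ) : ContDiff ℝ ∞ (fun r : ℝ => ψ (r • e0)) :=
  hs.comp (contDiff_id.smul contDiff_const)

lemma deriv_line (hs : ContDiff ℝ ∞ ψ) (r : ℝ) :
    deriv (fun r : ℝ => ψ (r • e0)) r = fderiv ℝ ψ (r • e0) e0 := by
  have h1 := (hs.differentiable (by simp) (r • e0)).hasFDerivAt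
  have h2 : HasDerivAt (fun r : ℝ => r • e0) e0 r := by
    simpa using (hasDerivAt_id r).smul_const e0
  exact (h1.comp_hasDerivAt r h2).deriv

lemma deriv_smoothC {f : ℝ → ℂ} (hf : ContDiff ℝ ∞ f) : ContDiff ℝ ∞ (deriv f) :=
  ((contDiff_infty_iff_deriv (𝕜 := ℝ)).1 hf).2

lemma fderiv_radial' (hs : ContDiff ℝ ∞ ψ) (hr : ∀ x y : R3, ‖x‖ = ‖y‖ → ψ x = ψ y) {x : R3}
    (hx : x ≠ 0) (v : R3) : fderiv ℝ ψ x v =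
      ((‖x‖⁻¹ * inner ℝ x v : ℝ) : ℂ) * deriv (fun r : ℝ => ψ (r • e0)) ‖x‖ :=
  fderiv_radial (U := fun r : ℝ => ψ (r • e0)) hx (Eventually.of_forall fun y => radial_eq hr y)
    ((line_smooth hs).differentiable (by simp) _).hasDerivAt v

lemma deriv_line_le (hs : ContDiff ℝ ∞ ψ) (hr : ∀ x y : R3, ‖x‖ = ‖y‖ → ψ x = ψ y) {x : R3}
    (hx : x ≠ 0) : ‖deriv (fun r : ℝ => ψ (r • e0)) ‖x‖‖ ≤ ‖fderiv ℝ ψ x‖ := by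
  have hx' : ‖x‖ ≠ 0 := norm_ne_zero_iff.2 hx
  have h := fderiv_radial' hs hr hx (‖x‖⁻¹ • x)
  have e : ‖x‖⁻¹ * inner ℝ x (‖x‖⁻¹ • x) = 1 := by
    rw [inner_smul_right, real_inner_self_eq_norm_sq]
    field_simp
  rw [e] at h
  simp only [Complex.ofReal_one, one_mul] at h
  rw [← h]
  have := (fderiv ℝ ψ x).le_opNorm (‖x‖⁻¹ • x)
  rw [norm_smul, norm_inv, norm_norm, inv_mul_cancel₀ hx', mul_one] at this
  exact this

lemma lap_radial (hs : ContDiff ℝ ∞ ψ) (hr : ∀ x y : R3, ‖x‖ = ‖y‖ → ψ x = ψ y) {r : ℝ}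
    (hr0 : 0 < r) : (r : ℂ) * laplacian ψ (r • e0) =
      r * deriv (deriv (fun r : ℝ => ψ (r • e0))) r + 2 * deriv (fun r : ℝ => ψ (r • e0)) r := by
  have hdiff : ∀ v : R3, Differentiable ℝ (fun y => fderiv ℝ ψ y v) := by
    intro v
    have : ContDiff ℝ ∞ (fderiv ℝ ψ) := hs.fderiv_right (by simp)
    exact (this.clm_apply contDiff_const).differentiable (by simp)
  have hline : ∀ (v w x : R3), fderiv ℝ (fun y => fderiv ℝ ψ y v) x w =
      deriv (fun s : ℝ => fderiv ℝ ψ (x + s • w) v) 0 := by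
    intro v w x
    have h2 : HasDerivAt (fun s : ℝ => x + s • w) w 0 := by
      simpa using ((hasDerivAt_id (0:ℝ)).smul_const w).const_add x
    have h1 := (hdiff v (x + (0:ℝ) • w)).hasFDerivAt
    have := (h1.comp_hasDerivAt 0 h2).deriv
    simp only [zero_smul, add_zero] at this
    exact this.symm
  set u : ℝ → ℂ := fun r : ℝ => ψ (r • e0) with hu
  have hu_s : ContDiff ℝ ∞ u := line_smooth hs
  have hu1 := deriv_smoothC hu_s
  have j0 : fderiv ℝ (fun y => fderiv ℝ ψ y e0) (r • e0) e0 = deriv (deriv u) r := by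
    have h1 := (hdiff e0 (r • e0)).hasFDerivAt
    have h2 : HasDerivAt (fun r : ℝ => r • e0) e0 r := by
      simpa using (hasDerivAt_id r).smul_const e0
    rw [← (h1.comp_hasDerivAt r h2).deriv]
    congr 1
    funext s
    exact (deriv_line hs s).symm
  have jj : ∀ w : R3, inner ℝ e0 w = 0 → inner ℝ w w = (1:ℝ) →
      fderiv ℝ (fun y => fderiv ℝ ψ y w) (r • e0) w = (r : ℂ)⁻¹ * deriv u r := by
    intro w hw0 hw1
    rw [hline]
    have hne : ∀ s : ℝ, r • e0 + s • w ≠ 0 := by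
      intro s h
      have : inner ℝ e0 (r • e0 + s • w) = (0:ℝ) := by rw [h]; simp
      rw [inner_add_right, inner_smul_right, inner_smul_right, hw0, real_inner_self_eq_norm_sq,
        norm_e0] at this
      simp at this
      linarith
    let k : ℝ → ℂ := fun s => ((‖r • e0 + s • w‖⁻¹ : ℝ) : ℂ) * deriv u ‖r • e0 + s • w‖
    have hfun : (fun s : ℝ => fderiv ℝ ψ (r • e0 + s • w) w) = fun s : ℝ => (s : ℂ) * k s := by
      funext s
      rw [fderiv_radial' hs hr (hne s)]
      have : inner ℝ (r • e0 + s • w) w = s := by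
        rw [inner_add_left, real_inner_smul_left, real_inner_smul_left, hw0, hw1]; ring
      rw [this]
      simp only [k]
      push_cast
      ring
    have hN : DifferentiableAt ℝ (fun s : ℝ => ‖r • e0 + s • w‖) 0 := by
      have h : DifferentiableAt ℝ (fun s : ℝ => r • e0 + s • w) 0 := by fun_prop
      exact h.norm ℝ (hne 0)
    have hk : DifferentiableAt ℝ k 0 := by
      apply DifferentiableAt.mul
      · have h1 : DifferentiableAt ℝ (fun s : ℝ => ‖r • e0 + s • w‖⁻¹) 0 :=
          hN.inv (norm_ne_zero_iff.2 (hne 0))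
        exact Complex.ofRealCLM.differentiableAt.comp 0 h1
      · exact (hu1.differentiable (by simp) _).comp 0 hN
    rw [hfun]
    have hid : HasDerivAt (fun s : ℝ => (s : ℂ)) 1 0 := Complex.ofRealCLM.hasDerivAt
    refine (hid.mul hk.hasDerivAt).deriv.trans ?_
    simp [k, norm_smul_e0, abs_of_pos hr0]
  have hlap : laplacian ψ (r • e0) = deriv (deriv u) r + (r : ℂ)⁻¹ * deriv u r
      + (r : ℂ)⁻¹ * deriv u r := by
    unfold laplacian
    rw [Fin.sum_univ_three, jj (EuclideanSpace.single 1 1), jj (EuclideanSpace.single 2 1)]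
    · rw [← j0]; rfl
    all_goals simp [e0, EuclideanSpace.inner_single_left]
  rw [hlap]
  have : (r : ℂ) ≠ 0 := by exact_mod_cast hr0.ne'
  field_simp
  ring
end radial

lemma Dr_slice {u : ℝ × ℝ → ℝ} (hu : ContDiffOn ℝ ∞ u Om) {t r : ℝ} (ht : 0 < t) :
    HasDerivAt (fun y => u (t, y)) (Dr u (t, r)) r := by
  have h2 : HasDerivAt (fun y : ℝ => ((t, y) : ℝ × ℝ)) (0, 1) r :=
    (hasDerivAt_const r t).prodMk (hasDerivAt_id r)
  have hp : ((t, r) : ℝ × ℝ) ∈ Om := ⟨ht, trivial⟩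
  exact (diffAt_Om hu hp).hasFDerivAt.comp_hasDerivAt r h2

lemma Dt_slice {u : ℝ × ℝ → ℝ} (hu : ContDiffOn ℝ ∞ u Om) {t r : ℝ} (ht : 0 < t) :
    HasDerivAt (fun y => u (y, r)) (Dt u (t, r)) t := by
  have h2 : HasDerivAt (fun y : ℝ => ((y, r) : ℝ × ℝ)) (1, 0) t :=
    (hasDerivAt_id t).prodMk (hasDerivAt_const t r)
  have hp : ((t, r) : ℝ × ℝ) ∈ Om := ⟨ht, trivial⟩
  exact (diffAt_Om hu hp).hasFDerivAt.comp_hasDerivAt t h2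

section sol
variable {N : ℝ → ℝ → ℝ → ℝ} {φ : ℝ → R3 → ℂ}

/-- real part of `r φ(t, r e0)` -/
def aF (φ : ℝ → R3 → ℂ) (p : ℝ × ℝ) : ℝ := p.2 * (φ p.1 (p.2 • e0)).re
/-- imaginary part of `r φ(t, r e0)` -/
def bF (φ : ℝ → R3 → ℂ) (p : ℝ × ℝ) : ℝ := p.2 * (φ p.1 (p.2 • e0)).im

/-- the radial profile -/
def uF (φ : ℝ → R3 → ℂ) (t r : ℝ) : ℂ := φ t (r • e0)

lemma prof_smooth (h : SolSetting N φ) :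
    ContDiffOn ℝ ∞ (fun p : ℝ × ℝ => φ p.1 (p.2 • e0)) Om := by
  refine h.smooth.comp (f := fun p : ℝ × ℝ => ((p.1, p.2 • e0) : ℝ × R3)) ?_ ?_
  · exact contDiffOn_fst.prodMk (contDiffOn_snd.smul contDiffOn_const)
  · rintro ⟨t, r⟩ hp
    exact ⟨show (0:ℝ) ≤ t from le_of_lt hp.1, trivial⟩

lemma aF_smooth (h : SolSetting N φ) : ContDiffOn ℝ ∞ (aF φ) Om :=
  contDiffOn_snd.mul (Complex.reCLM.contDiff.comp_contDiffOn (prof_smooth h))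

lemma bF_smooth (h : SolSetting N φ) : ContDiffOn ℝ ∞ (bF φ) Om :=
  contDiffOn_snd.mul (Complex.imCLM.contDiff.comp_contDiffOn (prof_smooth h))

lemma slice_smooth (h : SolSetting N φ) {t : ℝ} (ht : 0 < t) : ContDiff ℝ ∞ (φ t) := by
  rw [← contDiffOn_univ]
  refine h.smooth.comp (f := fun x : R3 => ((t, x) : ℝ × R3)) ?_ ?_
  · exact contDiffOn_const.prodMk contDiffOn_id
  · intro x _
    exact ⟨ht.le, trivial⟩

lemma uF_smooth (h : SolSetting N φ) {t : ℝ} (ht : 0 < t) : ContDiff ℝ ∞ (uF φ t) :=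
  line_smooth (slice_smooth h ht)

lemma hd_re {f : ℝ → ℂ} {d : ℂ} {r : ℝ} (h : HasDerivAt f d r) :
    HasDerivAt (fun y => (f y).re) d.re r :=
  Complex.reCLM.hasFDerivAt.comp_hasDerivAt r h
lemma hd_im {f : ℝ → ℂ} {d : ℂ} {r : ℝ} (h : HasDerivAt f d r) :
    HasDerivAt (fun y => (f y).im) d.im r :=
  Complex.imCLM.hasFDerivAt.comp_hasDerivAt r h

lemma hd_u (h : SolSetting N φ) {t : ℝ} (ht : 0 < t) (r : ℝ) :
    HasDerivAt (uF φ t) (deriv (uF φ t) r) r :=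
  ((uF_smooth h ht).differentiable (by simp) r).hasDerivAt

lemma hd_u' (h : SolSetting N φ) {t : ℝ} (ht : 0 < t) (r : ℝ) :
    HasDerivAt (deriv (uF φ t)) (deriv (deriv (uF φ t)) r) r :=
  ((deriv_smoothC (uF_smooth h ht)).differentiable (by simp) r).hasDerivAt

lemma Dr_aF (h : SolSetting N φ) {t : ℝ} (ht : 0 < t) (r : ℝ) :
    Dr (aF φ) (t, r) = (uF φ t r).re + r * (deriv (uF φ t) r).re := by
  refine (Dr_slice (aF_smooth h) ht).unique ?_
  have := (hasDerivAt_id r).mul (hd_re (hd_u h ht r))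
  exact this.congr_deriv (by simp)

lemma Dr_bF (h : SolSetting N φ) {t : ℝ} (ht : 0 < t) (r : ℝ) :
    Dr (bF φ) (t, r) = (uF φ t r).im + r * (deriv (uF φ t) r).im := by
  refine (Dr_slice (bF_smooth h) ht).unique ?_
  have := (hasDerivAt_id r).mul (hd_im (hd_u h ht r))
  exact this.congr_deriv (by simp)

lemma Drr_aF (h : SolSetting N φ) {t : ℝ} (ht : 0 < t) (r : ℝ) :
    Dr (Dr (aF φ)) (t, r) = 2 * (deriv (uF φ t) r).re + r * (deriv (deriv (uF φ t)) r).re := by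
  refine (Dr_slice (Dr_smooth (aF_smooth h)) ht).unique ?_
  simp only [Dr_aF h ht]
  have := (hd_re (hd_u h ht r)).add ((hasDerivAt_id r).mul (hd_re (hd_u' h ht r)))
  exact this.congr_deriv (by simp; ring)

lemma Drr_bF (h : SolSetting N φ) {t : ℝ} (ht : 0 < t) (r : ℝ) :
    Dr (Dr (bF φ)) (t, r) = 2 * (deriv (uF φ t) r).im + r * (deriv (deriv (uF φ t)) r).im := by
  refine (Dr_slice (Dr_smooth (bF_smooth h)) ht).unique ?_
  simp only [Dr_bF h ht]
  have := (hd_im (hd_u h ht r)).add ((hasDerivAt_id r).mul (hd_im (hd_u' h ht r)))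
  exact this.congr_deriv (by simp; ring)

lemma hd_time (h : SolSetting N φ) {t : ℝ} (ht : 0 < t) (r : ℝ) :
    HasDerivAt (fun s => φ s (r • e0)) (deriv (fun s => φ s (r • e0)) t) t := by
  have hp : ((t, r) : ℝ × ℝ) ∈ Om := ⟨ht, trivial⟩
  have h1 : DifferentiableAt ℝ (fun p : ℝ × ℝ => φ p.1 (p.2 • e0)) (t, r) :=
    ((prof_smooth h).contDiffAt (isOpen_Om.mem_nhds hp)).differentiableAt (by simp)
  have h2 : DifferentiableAt ℝ (fun y : ℝ => ((y, r) : ℝ × ℝ)) t := by fun_prop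
  exact (h1.comp t h2).hasDerivAt

lemma Dt_aF (h : SolSetting N φ) {t : ℝ} (ht : 0 < t) (r : ℝ) :
    Dt (aF φ) (t, r) = r * (deriv (fun s => φ s (r • e0)) t).re :=
  (Dt_slice (aF_smooth h) ht).unique ((hd_re (hd_time h ht r)).const_mul r)

lemma Dt_bF (h : SolSetting N φ) {t : ℝ} (ht : 0 < t) (r : ℝ) :
    Dt (bF φ) (t, r) = r * (deriv (fun s => φ s (r • e0)) t).im :=
  (Dt_slice (bF_smooth h) ht).unique ((hd_im (hd_time h ht r)).const_mul r)

lemma pde1 (h : SolSetting N φ) {t r : ℝ} (ht : 0 < t) (hr : 0 < r) :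
    Dr (Dr (aF φ)) (t, r) - Dt (bF φ) (t, r) = N ‖φ t (r • e0)‖ r t * aF φ (t, r) ∧
    Dr (Dr (bF φ)) (t, r) + Dt (aF φ) (t, r) = N ‖φ t (r • e0)‖ r t * bF φ (t, r) := by
  have heq := h.eqn t ht.le (r • e0)
  rw [norm_smul_e0, abs_of_pos hr] at heq
  have hlap := lap_radial (slice_smooth h ht) (h.radial t) hr
  have heq2 := congrArg (fun z => (r : ℂ) * z) heq
  simp only [mul_add] at heq2
  rw [hlap] at heq2
  have hre := congrArg Complex.re heq2
  have him := congrArg Complex.im heq2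
  rw [Drr_aF h ht, Drr_bF h ht, Dt_aF h ht, Dt_bF h ht]
  simp at hre him
  simp only [aF, bF]
  have eu : uF φ t = fun r : ℝ => φ t (r • e0) := rfl
  rw [eu]
  constructor
  · linarith
  · linarith

lemma Q_le (h : SolSetting N φ) {t r : ℝ} (ht : 0 < t) (hr : 1 ≤ r) :
    Qen (aF φ) (bF φ) (t, r) ≤ 3 * (r ^ 2 * ‖uF φ t r‖ ^ 2 + r ^ 2 * ‖deriv (uF φ t) r‖ ^ 2) := by
  unfold Qen
  rw [Dr_aF h ht, Dr_bF h ht]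
  have e : aF φ (t, r) = r * (uF φ t r).re := rfl
  have e' : bF φ (t, r) = r * (uF φ t r).im := rfl
  rw [e, e', ← Complex.normSq_eq_norm_sq, ← Complex.normSq_eq_norm_sq, Complex.normSq_apply,
    Complex.normSq_apply]
  generalize (uF φ t r).re = x
  generalize (uF φ t r).im = y
  generalize (deriv (uF φ t) r).re = x'
  generalize (deriv (uF φ t) r).im = y'
  have hr2 : 1 ≤ r ^ 2 := by nlinarith
  have k1 : x ^ 2 ≤ r ^ 2 * x ^ 2 := le_mul_of_one_le_left (sq_nonneg _) hr2
  have k2 : y ^ 2 ≤ r ^ 2 * y ^ 2 := le_mul_of_one_le_left (sq_nonneg _) hr2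
  have k3 : 0 ≤ r ^ 2 * x' ^ 2 := by positivity
  have k4 : 0 ≤ r ^ 2 * y' ^ 2 := by positivity
  have k5 := sq_nonneg (x - r * x')
  have k6 := sq_nonneg (y - r * y')
  linarith

/-- the polar constant -/
def kap : ℝ := 3 * (volume : Measure R3).real (Metric.ball 0 1)

lemma kap_pos : 0 < kap := by
  unfold kap
  have : 0 < (volume : Measure R3).real (Metric.ball 0 1) := by
    rw [Measure.real, ENNReal.toReal_pos_iff]
    exact ⟨Metric.measure_ball_pos _ _ one_pos, measure_ball_lt_top⟩
  positivity

lemma polar {E : Type*} [NormedAddCommGroup E] [NormedSpace ℝ E] (f : ℝ → E) :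
    ∫ x : R3, f ‖x‖ = kap • ∫ r in Set.Ioi (0:ℝ), r ^ 2 • f r := by
  have := integral_fun_norm_addHaar (volume : Measure R3) f
  rw [this]
  simp only [finrank_euclideanSpace, Fintype.card_fin, kap]
  rw [mul_smul, ← Nat.cast_smul_eq_nsmul ℝ]
  norm_num

lemma polar_int {E : Type*} [NormedAddCommGroup E] [NormedSpace ℝ E] {f : ℝ → E} :
    Integrable (fun x : R3 => f ‖x‖) ↔ IntegrableOn (fun r : ℝ => r ^ 2 • f r) (Set.Ioi 0) := by
  have := integrable_fun_norm_addHaar (volume : Measure R3) (f := f)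
  rw [this]
  simp only [finrank_euclideanSpace, Fintype.card_fin]
  try rfl

lemma u_int (h : SolSetting N φ) {t : ℝ} (ht : 0 < t) :
    IntegrableOn (fun r => r ^ 2 * ‖uF φ t r‖ ^ 2) (Set.Ioi 0) ∧
    kap * ∫ r in Set.Ioi (0:ℝ), r ^ 2 * ‖uF φ t r‖ ^ 2 = ∫ x : R3, ‖φ t x‖ ^ 2 := by
  have e : (fun x : R3 => ‖φ t x‖ ^ 2) = fun x : R3 => (fun r => ‖uF φ t r‖ ^ 2) ‖x‖ := by
    funext x
    rw [radial_eq (h.radial t) x]; rfl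
  have h1 := h.l2 t ht.le
  rw [e]
  rw [e] at h1
  exact ⟨polar_int.1 h1, (polar (fun r => ‖uF φ t r‖ ^ 2)).symm⟩

lemma u'_int (h : SolSetting N φ) {t : ℝ} (ht : 0 < t) :
    IntegrableOn (fun r => r ^ 2 * ‖deriv (uF φ t) r‖ ^ 2) (Set.Ioi 0) ∧
    kap * ∫ r in Set.Ioi (0:ℝ), r ^ 2 * ‖deriv (uF φ t) r‖ ^ 2 ≤
      ∫ x : R3, ‖fderiv ℝ (φ t) x‖ ^ 2 := by
  have h1 := h.grad_l2 t ht.le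
  have hle : ∀ᵐ x : R3, ‖deriv (uF φ t) ‖x‖‖ ^ 2 ≤ ‖fderiv ℝ (φ t) x‖ ^ 2 := by
    have : ∀ᵐ x : R3, x ≠ 0 := by
      simp [ae_iff]
    filter_upwards [this] with x hx
    have := deriv_line_le (slice_smooth h ht) (h.radial t) hx
    exact pow_le_pow_left₀ (norm_nonneg _) this 2
  have hc : Continuous (fun x : R3 => ‖deriv (uF φ t) ‖x‖‖ ^ 2) :=
    ((deriv_smoothC (uF_smooth h ht)).continuous.comp continuous_norm).norm.pow 2
  have h2 : Integrable (fun x : R3 => ‖deriv (uF φ t) ‖x‖‖ ^ 2) := by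
    refine h1.mono' hc.aestronglyMeasurable ?_
    filter_upwards [hle] with x hx
    rwa [Real.norm_of_nonneg (by positivity)]
  refine ⟨(polar_int (f := fun r => ‖deriv (uF φ t) r‖ ^ 2)).1 h2, ?_⟩
  have := polar (fun r => ‖deriv (uF φ t) r‖ ^ 2)
  simp only [smul_eq_mul] at this
  rw [← this]
  exact integral_mono_ae h2 h1 hle

lemma Q_int (h : SolSetting N φ) : ∃ C1, ∀ t, 0 < t →
    IntegrableOn (fun r => Qen (aF φ) (bF φ) (t, r)) (Set.Ioi 1) ∧
    ∫ r in Set.Ioi (1:ℝ), Qen (aF φ) (bF φ) (t, r) ≤ C1 := by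
  obtain ⟨C, hC⟩ := h.H1
  refine ⟨3 * (kap⁻¹ * C), fun t ht => ?_⟩
  obtain ⟨i1, j1⟩ := u_int h ht
  obtain ⟨i2, j2⟩ := u'_int h ht
  have i3 : IntegrableOn (fun r => 3 * (r ^ 2 * ‖uF φ t r‖ ^ 2 +
      r ^ 2 * ‖deriv (uF φ t) r‖ ^ 2)) (Set.Ioi 0) := (i1.add i2).const_mul 3
  have hsub : Set.Ioi (1:ℝ) ⊆ Set.Ioi 0 := Set.Ioi_subset_Ioi zero_le_one
  have i4 := IntegrableOn.mono_set i3 hsub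
  have hle : ∀ᵐ r ∂(volume.restrict (Set.Ioi (1:ℝ))), Qen (aF φ) (bF φ) (t, r) ≤
      3 * (r ^ 2 * ‖uF φ t r‖ ^ 2 + r ^ 2 * ‖deriv (uF φ t) r‖ ^ 2) := by
    filter_upwards [ae_restrict_mem measurableSet_Ioi] with r hr
    exact Q_le h ht (le_of_lt hr)
  have hI : IntegrableOn (fun r => Qen (aF φ) (bF φ) (t, r)) (Set.Ioi 1) := by
    refine Integrable.mono' i4
      (slice_cont (Qen_smooth (aF_smooth h) (bF_smooth h)) ht).aestronglyMeasurable ?_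
    filter_upwards [hle] with r hr
    rw [Real.norm_of_nonneg (Qen_nonneg _ _ _)]
    exact hr
  refine ⟨hI, ?_⟩
  calc _ ≤ ∫ r in Set.Ioi (1:ℝ), 3 * (r ^ 2 * ‖uF φ t r‖ ^ 2 + r ^ 2 * ‖deriv (uF φ t) r‖ ^ 2) :=
        integral_mono_ae hI i4 hle
    _ ≤ ∫ r in Set.Ioi (0:ℝ), 3 * (r ^ 2 * ‖uF φ t r‖ ^ 2 + r ^ 2 * ‖deriv (uF φ t) r‖ ^ 2) := by
        apply setIntegral_mono_set i3
        · exact Eventually.of_forall fun r => by simp only [Pi.zero_apply]; positivity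
        · exact hsub.eventuallyLE
    _ = 3 * ((∫ r in Set.Ioi (0:ℝ), r ^ 2 * ‖uF φ t r‖ ^ 2)
        + ∫ r in Set.Ioi (0:ℝ), r ^ 2 * ‖deriv (uF φ t) r‖ ^ 2) := by
        rw [integral_const_mul, integral_add i1 i2]
    _ ≤ 3 * (kap⁻¹ * C) := by
        have := hC t ht.le
        have hk := kap_pos
        gcongr
        rw [inv_mul_eq_div, le_div_iff₀ hk]
        linarith

set_option maxHeartbeats 1000000 in
lemma gamma_eq {g : R3 → ℝ} {β : ℝ → ℝ} (hg : GoodG g β) (h : SolSetting N φ) {F : ℝ → ℝ}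
    (hF : IsSmoothChar F) {α t : ℝ} (ht : 0 < t) (htα : 4 ≤ t ^ α) :
    GammaF g φ F α t = kap * ∫ r in Set.Ioi (1:ℝ), F (r * t ^ (-α)) ^ 2 *
      (aF φ (t, r) * Dr (bF φ) (t, r) - bF φ (t, r) * Dr (aF φ) (t, r)) := by
  set s := t ^ (-α) with hs
  have hsinv : s = (t ^ α)⁻¹ := Real.rpow_neg ht.le α
  have hs0 : 0 < s := by rw [hsinv]; positivity
  have hs4 : s ≤ 1 / 4 := by
    rw [hsinv, one_div]; exact inv_anti₀ (by norm_num) htα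
  have hF0 : ∀ r, r ≤ 2 → F (r * s) = 0 := by
    intro r hr
    apply hF.2.2.1
    nlinarith
  let u := uF φ t
  have hu := hd_u h ht
  let U : ℝ → ℂ := fun r => (F (r * s) : ℂ) * uF φ t r
  let U' : ℝ → ℂ := fun r => ((deriv F (r * s) * s : ℝ) : ℂ) * uF φ t r
    + (F (r * s) : ℂ) * deriv (uF φ t) r
  have hU : ∀ r, HasDerivAt U (U' r) r := by
    intro r
    have h1 : HasDerivAt (fun r : ℝ => ((F (r * s) : ℝ) : ℂ)) ((deriv F (r * s) * s : ℝ) : ℂ) r :=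
      (hd_lam hF.1 s r).ofReal_comp
    exact h1.mul (hu r)
  let H : ℝ → ℂ := fun r => (starRingEnd ℂ) (U r) * U' r
  have hint : ∀ x : R3, (starRingEnd ℂ) ((F (g x / t ^ α) : ℂ) * φ t x) *
      fderiv ℝ (fun x => (F (g x / t ^ α) : ℂ) * φ t x) x (gradient g x) = H ‖x‖ := by
    intro x
    by_cases hx : ‖x‖ ≤ 2
    · have h1 : g x ≤ 2 := by
        rw [hg.g_eq, ← hg.beta_eq_id 2 le_rfl]
        exact hg.mono_beta (norm_nonneg _) (by simp) hx
      have h2 : F (g x / t ^ α) = 0 := by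
        apply hF.2.2.1
        rw [div_le_iff₀ (by linarith)]
        linarith
      simp only [H, U, h2, hF0 _ hx]
      simp
    · have hx2 : 2 < ‖x‖ := not_le.1 hx
      have hxn : ‖x‖ ≠ 0 := by linarith
      have hx0 : x ≠ 0 := norm_ne_zero_iff.1 hxn
      have hnear : ∀ᶠ y : R3 in 𝓝 x, g y = ‖y‖ := by
        filter_upwards [continuous_norm.continuousAt.eventually (Ioi_mem_nhds hx2)] with y hy
        rw [hg.g_eq, hg.beta_eq_id _ (le_of_lt hy)]
      have hgrad : gradient g x = ‖x‖⁻¹ • x := by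
        apply HasGradientAt.gradient
        rw [hasGradientAt_iff_hasFDerivAt]
        refine HasFDerivAt.congr_of_eventuallyEq ?_ hnear
        refine (hasFDerivAt_norm3 hx0).congr_fderiv ?_
        ext v
        simp
      have hUeq : ∀ y : R3, g y = ‖y‖ → (F (g y / t ^ α) : ℂ) * φ t y = U ‖y‖ := by
        intro y hy
        rw [hy, radial_eq (h.radial t) y]
        simp only [U, hsinv, uF, div_eq_mul_inv]
      have hfd := fderiv_radial (U := U) hx0 (hnear.mono hUeq) (hU ‖x‖) (gradient g x)
      rw [hfd, hUeq x hnear.self_of_nhds, hgrad]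
      have e : ‖x‖⁻¹ * inner ℝ x (‖x‖⁻¹ • x) = 1 := by
        rw [inner_smul_right, real_inner_self_eq_norm_sq]
        field_simp
      rw [e]
      simp [H]
  unfold GammaF gammaExp
  simp only [hint]
  rw [polar H]
  obtain ⟨B, hB, hFb⟩ := char_bounds hF
  have hcU : Continuous U := continuous_iff_continuousAt.2 fun r => (hU r).continuousAt
  have hcU' : Continuous U' := by
    have c1 := (uF_smooth h ht).continuous
    have c2 := (deriv_smoothC (uF_smooth h ht)).continuous
    have c3 := hF.1.continuous
    have c4 := (deriv_smooth hF.1).continuous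
    have c5 : Continuous fun r : ℝ => r * s := by fun_prop
    exact ((Complex.continuous_ofReal.comp ((c4.comp c5).mul continuous_const)).mul c1).add
      ((Complex.continuous_ofReal.comp (c3.comp c5)).mul c2)
  have hcH : Continuous H := (Complex.continuous_conj.comp hcU).mul hcU'
  have hi : IntegrableOn (fun r : ℝ => r ^ 2 • H r) (Set.Ioi 0) := by
    have i3 := ((u_int h ht).1.add (u'_int h ht).1).const_mul (B + 1)
    refine Integrable.mono' i3 (((continuous_pow 2).smul hcH).aestronglyMeasurable) ?_
    refine Eventually.of_forall fun r => ?_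
    have hFr := hF.2.2.2.2 (r * s)
    have n1 : ‖U r‖ ≤ ‖uF φ t r‖ := by
      simp only [U, norm_mul, Complex.norm_real, Real.norm_eq_abs, abs_of_nonneg hFr.1]
      exact mul_le_of_le_one_left (norm_nonneg _) hFr.2
    have n2 : ‖U' r‖ ≤ B * ‖uF φ t r‖ + ‖deriv (uF φ t) r‖ := by
      refine (norm_add_le _ _).trans (add_le_add ?_ ?_)
      · simp only [norm_mul, Complex.norm_real, Real.norm_eq_abs, abs_mul, abs_of_pos hs0]
        have k1 := (hFb (r * s)).1
        have : |deriv F (r * s)| * s ≤ B * 1 := by gcongr; linarith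
        rw [mul_one] at this
        gcongr
      · simp only [norm_mul, Complex.norm_real, Real.norm_eq_abs, abs_of_nonneg hFr.1]
        exact mul_le_of_le_one_left (norm_nonneg _) hFr.2
    have n3 : ‖H r‖ ≤ (B + 1) * (‖uF φ t r‖ ^ 2 + ‖deriv (uF φ t) r‖ ^ 2) := by
      have : ‖H r‖ ≤ ‖uF φ t r‖ * (B * ‖uF φ t r‖ + ‖deriv (uF φ t) r‖) := by
        simp only [H, norm_mul, RCLike.norm_conj]
        gcongr
      refine this.trans ?_
      generalize ‖uF φ t r‖ = x
      generalize ‖deriv (uF φ t) r‖ = y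
      have k1 : 0 ≤ B * y ^ 2 := by positivity
      nlinarith [sq_nonneg (x - y), sq_nonneg x, sq_nonneg y]
    rw [norm_smul, Real.norm_of_nonneg (sq_nonneg r)]
    have := mul_le_mul_of_nonneg_left n3 (sq_nonneg r)
    simp only [Pi.add_apply]
    linarith
  have him : (∫ r in Set.Ioi (0:ℝ), r ^ 2 • H r).im = ∫ r in Set.Ioi (0:ℝ), (r ^ 2 • H r).im := by
    have := Complex.imCLM.integral_comp_comm hi
    exact this.symm
  rw [Complex.smul_im, him, smul_eq_mul]
  congr 1
  have hpt : ∀ r, (r ^ 2 • H r).im = F (r * s) ^ 2 *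
      (aF φ (t, r) * Dr (bF φ) (t, r) - bF φ (t, r) * Dr (aF φ) (t, r)) := by
    intro r
    rw [Dr_aF h ht, Dr_bF h ht]
    have e : aF φ (t, r) = r * (uF φ t r).re := rfl
    have e' : bF φ (t, r) = r * (uF φ t r).im := rfl
    rw [e, e', Complex.smul_im]
    simp only [H, U, U', smul_eq_mul]
    simp
    ring
  simp only [hpt]
  apply setIntegral_eq_of_subset_of_forall_sdiff_eq_zero measurableSet_Ioi
    (Set.Ioi_subset_Ioi zero_le_one)
  rintro r ⟨hr1, hr2⟩
  have : r ≤ 1 := not_lt.1 hr2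
  rw [hF0 r (by linarith)]
  simp
end sol

/-- Existence of the γ-limit: under (H1) and (H2)[α] for a fixed `α ∈ (1/3,1)`,
for every smooth characteristic function `F` of `[1,∞)` the limit
`lim_{t→∞} Γ_{F,α}(t)` exists. -/
theorem gamma_limit_exists
    (g : R3 → ℝ) (β : ℝ → ℝ) (N : ℝ → ℝ → ℝ → ℝ) (φ : ℝ → R3 → ℂ)
    (hg : GoodG g β) (hφ : SolSetting N φ)
    (α : ℝ) (hα : α ∈ Set.Ioo (1 / 3 : ℝ) 1)
    (hH2 : ∃ β₀ > (1 : ℝ), H2 g N φ α β₀)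
    (F : ℝ → ℝ) (hF : IsSmoothChar F) :
    ∃ L : ℝ, Tendsto (fun t => GammaF g φ F α t) atTop (𝓝 L) := by
  obtain ⟨β₀, hβ₀, hH⟩ := hH2
  obtain ⟨C, hC, hN⟩ := hH F hF
  obtain ⟨C1, hQ⟩ := Q_int hφ
  have hα0 : 0 < α := by linarith [hα.1]
  obtain ⟨T, hT, hTα⟩ : ∃ T : ℝ, 1 ≤ T ∧ ∀ t, T ≤ t → 4 ≤ t ^ α := by
    obtain ⟨T, hT⟩ := eventually_atTop.1 ((tendsto_rpow_atTop hα0).eventually_ge_atTop 4)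
    exact ⟨max T 1, le_max_right _ _, fun t ht => hT t ((le_max_left _ _).trans ht)⟩
  obtain ⟨L, hL⟩ := oneD (aF_smooth hφ) (bF_smooth hφ) hF hα hC.le hβ₀
    (fun t r => N ‖φ t (r • e0)‖ r t) hT hTα
    (fun t ht r hr => (pde1 hφ (by linarith) (by linarith)).1)
    (fun t ht r hr => (pde1 hφ (by linarith) (by linarith)).2)
    (by
      intro t ht r hr
      have ht0 : 0 < t := by linarith
      have h4 := hTα t ht
      have hs : t ^ (-α) = (t ^ α)⁻¹ := Real.rpow_neg ht0.le α
      by_cases h2 : r ≤ 2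
      · have hz : F (r * t ^ (-α)) = 0 := by
          apply hF.2.2.1
          rw [hs, ← div_eq_mul_inv, div_le_iff₀ (by linarith)]
          linarith
        rw [hz, zero_mul, abs_zero]
        positivity
      · have hb := hN t (hT.trans ht) (r • e0)
        have hn : ‖r • e0‖ = r := by rw [norm_smul_e0, abs_of_nonneg (by linarith)]
        rw [hg.g_eq, hn, hg.beta_eq_id r (not_le.1 h2).le, div_eq_mul_inv, ← hs] at hb
        exact hb)
    (fun t ht => (hQ t (by linarith)).1) C1 (fun t ht => (hQ t (by linarith)).2)
  refine ⟨kap * L, (hL.const_mul kap).congr' ?_⟩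
  filter_upwards [eventually_ge_atTop T] with t ht
  exact (gamma_eq hg hφ hF (by linarith) (hTα t ht)).symm
end
end

section
/- Non-negativity of the γ-limit: Assume (H1) and (H2)[α] for a fixed α ∈ (1/3,1), and let F be a smooth characteristic function of [1,∞). If Γ_{F,α}(t) converges to a real number L as t → ∞, then L ≥ 0. -/
noncomputable section

open MeasureTheory Filter Topology Real

def HF (F : ℝ → ℝ) (s : ℝ) : ℝ := ∫ u in (0:ℝ)..s, F u ^ 2

/-- Truncated propagation weight. -/
def VV (F : ℝ → ℝ) (α R t y : ℝ) : ℝ := t ^ α * HF F (y / t ^ α) * (1 - F (y / R))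

/-- Its `y`-derivative. -/
def DD (F : ℝ → ℝ) (α R t y : ℝ) : ℝ :=
  F (y / t ^ α) ^ 2 * (1 - F (y / R)) - t ^ α * HF F (y / t ^ α) * (deriv F (y / R) / R)

lemma HF_hasDerivAt {F : ℝ → ℝ} (hF : IsSmoothChar F) (s : ℝ) :
    HasDerivAt (HF F) (F s ^ 2) s := by
  have hc : Continuous (fun u => F u ^ 2) := hF.1.continuous.pow 2
  exact intervalIntegral.integral_hasDerivAt_right (hc.intervalIntegrable _ _)
    hc.stronglyMeasurable.stronglyMeasurableAtFilter hc.continuousAt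

lemma HF_contDiff {F : ℝ → ℝ} (hF : IsSmoothChar F) : ContDiff ℝ 1 (HF F) := by
  rw [contDiff_one_iff_deriv]
  refine ⟨fun s => (HF_hasDerivAt hF s).differentiableAt, ?_⟩
  have : deriv (HF F) = fun s => F s ^ 2 := funext fun s => (HF_hasDerivAt hF s).deriv
  rw [this]
  exact hF.1.continuous.pow 2

lemma HF_bounds {F : ℝ → ℝ} (hF : IsSmoothChar F) (s : ℝ) :
    0 ≤ HF F s ∧ HF F s ≤ s * F s ^ 2 := by
  have hc : Continuous (fun u => F u ^ 2) := hF.1.continuous.pow 2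
  obtain ⟨h1, h2, h3, h4, h5⟩ := hF
  rcases le_total 0 s with hs | hs
  · constructor
    · exact intervalIntegral.integral_nonneg hs fun u _ => sq_nonneg _
    · have : HF F s ≤ ∫ u in (0:ℝ)..s, F s ^ 2 := by
        apply intervalIntegral.integral_mono_on hs (hc.intervalIntegrable _ _) (by simp)
        intro u hu
        exact pow_le_pow_left₀ (h5 u).1 (h2 hu.2) 2
      simpa using this
  · have h0 : HF F s = 0 := by
      unfold HF
      rw [intervalIntegral.integral_congr (g := fun _ => (0:ℝ))]
      · simp
      · intro u hu
        rw [Set.uIcc_of_ge hs] at hu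
        simp [h3 u (by linarith [hu.2])]
    rw [h0, h3 s (by linarith)]
    simp

lemma VV_bounds {F : ℝ → ℝ} (hF : IsSmoothChar F) {α R t : ℝ} (ht : 0 < t) (y : ℝ) :
    0 ≤ t ^ α * HF F (y / t ^ α) ∧ t ^ α * HF F (y / t ^ α) ≤ |y| := by
  have hp : 0 < t ^ α := rpow_pos_of_pos ht α
  obtain ⟨a, b⟩ := HF_bounds hF (y / t ^ α)
  obtain ⟨c, d⟩ := hF.2.2.2.2 (y / t ^ α)
  refine ⟨by positivity, ?_⟩
  calc t ^ α * HF F (y / t ^ α) ≤ t ^ α * (y / t ^ α * F (y / t ^ α) ^ 2) := by gcongr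
    _ = y * F (y / t ^ α) ^ 2 := by field_simp
    _ ≤ |y| * 1 := by
      refine mul_le_mul (le_abs_self y) (by nlinarith) (by positivity) (by positivity)
    _ = |y| := by ring

lemma VV_nonneg {F : ℝ → ℝ} (hF : IsSmoothChar F) {α R t : ℝ} (ht : 0 < t) (y : ℝ) :
    0 ≤ VV F α R t y ∧ VV F α R t y ≤ |y| := by
  obtain ⟨a, b⟩ := VV_bounds hF (α := α) (R := R) ht y
  obtain ⟨c, d⟩ := hF.2.2.2.2 (y / R)
  unfold VV
  constructor
  · exact mul_nonneg a (by linarith)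
  · nlinarith

lemma VV_zero {F : ℝ → ℝ} (hF : IsSmoothChar F) {α R t y : ℝ} (hR : 0 < R) (hy : R ≤ y) :
    VV F α R t y = 0 := by
  unfold VV
  rw [hF.2.2.2.1 (y / R) (by rwa [le_div_iff₀ hR, one_mul])]
  simp

lemma dF_zero_left {F : ℝ → ℝ} (hF : IsSmoothChar F) {s : ℝ} (hs : s < 1 / 2) :
    deriv F s = 0 := by
  have : F =ᶠ[𝓝 s] fun _ => (0:ℝ) := by
    filter_upwards [Iio_mem_nhds hs] with u hu using hF.2.2.1 u (le_of_lt hu)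
  rw [this.deriv_eq]; simp

lemma dF_zero_right {F : ℝ → ℝ} (hF : IsSmoothChar F) {s : ℝ} (hs : 1 < s) :
    deriv F s = 0 := by
  have : F =ᶠ[𝓝 s] fun _ => (1:ℝ) := by
    filter_upwards [Ioi_mem_nhds hs] with u hu using hF.2.2.2.1 u (le_of_lt hu)
  rw [this.deriv_eq]; simp

lemma dF_continuous {F : ℝ → ℝ} (hF : IsSmoothChar F) : Continuous (deriv F) :=
  hF.1.continuous_deriv (by exact_mod_cast le_top)

lemma dF_bound {F : ℝ → ℝ} (hF : IsSmoothChar F) :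
    ∃ C : ℝ, 0 ≤ C ∧ (∀ s, |deriv F s| ≤ C) ∧ ∀ s, |s| * |deriv F s| ≤ C := by
  obtain ⟨C, hC⟩ := (isCompact_Icc (a := (1/2:ℝ)) (b := 1)).exists_bound_of_continuousOn
    (dF_continuous hF).continuousOn
  have hC0 : 0 ≤ C := (norm_nonneg _).trans (hC 1 ⟨by norm_num, le_rfl⟩)
  refine ⟨C, hC0, fun s => ?_, fun s => ?_⟩
  · rcases lt_or_ge s (1/2) with h | h
    · simp [dF_zero_left hF h, hC0]
    rcases lt_or_ge 1 s with h' | h'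
    · simp [dF_zero_right hF h', hC0]
    exact hC s ⟨h, h'⟩
  · rcases lt_or_ge s (1/2) with h | h
    · simp [dF_zero_left hF h, hC0]
    rcases lt_or_ge 1 s with h' | h'
    · simp [dF_zero_right hF h', hC0]
    have := hC s ⟨h, h'⟩
    rw [Real.norm_eq_abs] at this
    have h2 : |s| ≤ 1 := by rw [abs_le]; constructor <;> linarith
    nlinarith [abs_nonneg s, abs_nonneg (deriv F s)]

lemma DD_bound {F : ℝ → ℝ} (hF : IsSmoothChar F) :
    ∃ C : ℝ, 0 ≤ C ∧ ∀ α R t y : ℝ, 0 < R → 0 < t → |DD F α R t y| ≤ C := by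
  obtain ⟨C, hC0, _, hC⟩ := dF_bound hF
  refine ⟨1 + C, by linarith, fun α R t y hR ht => ?_⟩
  obtain ⟨a, b⟩ := VV_bounds hF (α := α) (R := R) ht y
  obtain ⟨c, d⟩ := hF.2.2.2.2 (y / R)
  obtain ⟨c', d'⟩ := hF.2.2.2.2 (y / t ^ α)
  unfold DD
  refine (abs_sub _ _).trans (add_le_add ?_ ?_)
  · rw [abs_mul, abs_of_nonneg (by positivity), abs_of_nonneg (by linarith)]
    exact mul_le_one₀ (by nlinarith) (by linarith) (by linarith)
  · rw [abs_mul, abs_of_nonneg a, abs_div, abs_of_pos hR]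
    calc _ ≤ |y| * (|deriv F (y / R)| / R) := by gcongr
      _ = |y / R| * |deriv F (y / R)| := by rw [abs_div, abs_of_pos hR]; ring
      _ ≤ C := hC _

lemma DD_eventually {F : ℝ → ℝ} (hF : IsSmoothChar F) (α t y : ℝ) :
    ∀ᶠ n : ℕ in atTop, DD F α ((n:ℝ) + 1) t y = F (y / t ^ α) ^ 2 := by
  have : Tendsto (fun n : ℕ => y / ((n:ℝ) + 1)) atTop (𝓝 0) :=
    tendsto_const_nhds.div_atTop
      (tendsto_atTop_add_const_right _ _ tendsto_natCast_atTop_atTop)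
  filter_upwards [this.eventually (Iio_mem_nhds (show (0:ℝ) < 1/2 by norm_num))] with n hn
  unfold DD
  rw [hF.2.2.1 _ (le_of_lt hn), dF_zero_left hF hn]
  simp

lemma VV_hasDerivAt_y {F : ℝ → ℝ} (hF : IsSmoothChar F) {α R t : ℝ} (ht : 0 < t) (y : ℝ) :
    HasDerivAt (VV F α R t) (DD F α R t y) y := by
  have hp : t ^ α ≠ 0 := (rpow_pos_of_pos ht α).ne'
  have hFd : ∀ s, HasDerivAt F (deriv F s) s := fun s =>
    (hF.1.differentiable (by simp)).differentiableAt.hasDerivAt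
  have h1 : HasDerivAt (fun y => HF F (y / t ^ α)) (F (y / t ^ α) ^ 2 * (1 / t ^ α)) y :=
    (HF_hasDerivAt hF _).comp y ((hasDerivAt_id y).div_const _)
  have h2 : HasDerivAt (fun y => F (y / R)) (deriv F (y / R) * (1 / R)) y :=
    (hFd _).comp y ((hasDerivAt_id y).div_const _)
  refine ((h1.const_mul (t ^ α)).mul (h2.const_sub 1)).congr_deriv ?_
  unfold DD
  field_simp
  ring

lemma VV_hasDerivAt_t {F : ℝ → ℝ} (hF : IsSmoothChar F) {α R t : ℝ} (hα : 0 < α) (ht : 0 < t)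
    (y : ℝ) : ∃ v ≤ 0, HasDerivAt (fun t => VV F α R t y) v t := by
  have hp : 0 < t ^ α := (rpow_pos_of_pos ht α)
  have h0 : HasDerivAt (fun t : ℝ => t ^ α) (α * t ^ (α - 1)) t :=
    Real.hasDerivAt_rpow_const (Or.inl ht.ne')
  have h1 : HasDerivAt (fun t => HF F (y / t ^ α))
      (F (y / t ^ α) ^ 2 * (-(y * (α * t ^ (α - 1))) / (t ^ α) ^ 2)) t := by
    have := ((hasDerivAt_const t y).div h0 hp.ne')
    refine (HF_hasDerivAt hF _).comp t ?_
    exact this.congr_deriv (by ring)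
  refine ⟨_, ?_, (h0.mul h1).mul_const (1 - F (y / R))⟩
  obtain ⟨a, b⟩ := HF_bounds hF (y / t ^ α)
  obtain ⟨c, d⟩ := hF.2.2.2.2 (y / R)
  have hq : 0 < t ^ (α - 1) := rpow_pos_of_pos ht _
  refine mul_nonpos_of_nonpos_of_nonneg ?_ (by linarith)
  have : α * t ^ (α - 1) * HF F (y / t ^ α) +
      t ^ α * (F (y / t ^ α) ^ 2 * (-(y * (α * t ^ (α - 1))) / (t ^ α) ^ 2)) =
      α * t ^ (α - 1) * (HF F (y / t ^ α) - y / t ^ α * F (y / t ^ α) ^ 2) := by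
    field_simp
    ring
  rw [this]
  exact mul_nonpos_of_nonneg_of_nonpos (by positivity) (by linarith)

lemma VV_contDiffOn {F : ℝ → ℝ} (hF : IsSmoothChar F) {α R : ℝ} {g : R3 → ℝ}
    (hg : ContDiff ℝ (⊤ : ℕ∞) g) :
    ContDiffOn ℝ 1 (fun p : ℝ × R3 => VV F α R p.1 (g p.2)) (Set.Ioi 0 ×ˢ Set.univ) := by
  have hp : ContDiffOn ℝ 1 (fun p : ℝ × R3 => p.1 ^ α) (Set.Ioi 0 ×ˢ Set.univ) :=
    contDiff_fst.contDiffOn.rpow_const_of_ne fun x hx => (ne_of_gt hx.1)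
  have hg1 : ContDiff ℝ 1 (fun p : ℝ × R3 => g p.2) :=
    (hg.of_le (by exact_mod_cast le_top)).comp contDiff_snd
  have hF1 : ContDiff ℝ 1 F := hF.1.of_le (by exact_mod_cast le_top)
  unfold VV
  refine (hp.mul ((HF_contDiff hF).comp_contDiffOn (hg1.contDiffOn.div hp ?_))).mul ?_
  · intro x hx
    exact (rpow_pos_of_pos hx.1 α).ne'
  · exact (contDiff_const.sub (hF1.comp (hg1.div_const R))).contDiffOn

lemma DD_continuousOn {F : ℝ → ℝ} (hF : IsSmoothChar F) {α R : ℝ} {g : R3 → ℝ}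
    (hg : ContDiff ℝ (⊤ : ℕ∞) g) :
    ContinuousOn (fun p : ℝ × R3 => DD F α R p.1 (g p.2)) (Set.Ioi 0 ×ˢ Set.univ) := by
  have hp : ContinuousOn (fun p : ℝ × R3 => p.1 ^ α) (Set.Ioi 0 ×ˢ Set.univ) :=
    continuous_fst.continuousOn.rpow_const fun x hx => Or.inl (ne_of_gt hx.1)
  have hg1 : Continuous (fun p : ℝ × R3 => g p.2) := hg.continuous.comp continuous_snd
  have hq : ContinuousOn (fun p : ℝ × R3 => g p.2 / p.1 ^ α) (Set.Ioi 0 ×ˢ Set.univ) :=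
    hg1.continuousOn.div hp fun x hx => (rpow_pos_of_pos hx.1 α).ne'
  have hd := dF_continuous hF
  have hFc := hF.1.continuous
  unfold DD
  refine (((hFc.comp_continuousOn hq).pow 2).mul ?_).sub
    ((hp.mul ((HF_contDiff hF).continuous.comp_continuousOn hq)).mul ?_)
  · exact (continuous_const.sub (hFc.comp (hg1.div_const R))).continuousOn
  · exact ((hd.comp (hg1.div_const R)).div_const R).continuousOn

lemma DD_zero {F : ℝ → ℝ} (hF : IsSmoothChar F) {α R t y : ℝ} (hR : 0 < R) (hy : R < y) :
    DD F α R t y = 0 := by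
  have h : 1 < y / R := by rwa [lt_div_iff₀ hR, one_mul]
  unfold DD
  rw [hF.2.2.2.1 (y / R) h.le, dF_zero_right hF h]
  simp

lemma g_large {g : R3 → ℝ} {β : ℝ → ℝ} (hg : GoodG g β) {R : ℝ} (x : R3)
    (hx : x ∉ Metric.closedBall (0 : R3) (|R| + 2)) : R < g x := by
  simp only [Metric.mem_closedBall, dist_zero_right, not_le] at hx
  rw [hg.g_eq, hg.beta_eq_id _ (by linarith [abs_nonneg R])]
  linarith [le_abs_self R]

lemma g_lip {g : R3 → ℝ} {β : ℝ → ℝ} (hg : GoodG g β) : LipschitzWith 1 g := by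
  have key : ∀ x y : ℝ, 0 ≤ x → x < y → β y - β x ≤ y - x := by
    intro x y hx hxy
    set z := max y 2 with hz
    have h1 := hg.convex_beta.slope_mono_adjacent (x := x) (y := y) (z := z + 1) hx
      (by simp only [Set.mem_Ici]; linarith [le_max_left y 2]) hxy (by linarith [le_max_left y 2])
    have h3 : (β (z + 1) - β y) / (z + 1 - y) ≤ 1 := by
      rw [div_le_one (by linarith [le_max_left y 2])]
      rcases le_or_gt 2 y with h | h
      · have : z = y := max_eq_left h
        rw [this, hg.beta_eq_id y h, hg.beta_eq_id (y+1) (by linarith)]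
      · have hz2 : z = 2 := max_eq_right h.le
        have h4 := hg.convex_beta.slope_mono_adjacent (x := y) (y := 2) (z := 3)
          (by simp only [Set.mem_Ici]; linarith) (by simp) h (by norm_num)
        rw [hg.beta_eq_id 2 le_rfl, hg.beta_eq_id 3 (by norm_num), div_le_iff₀ (by linarith)] at h4
        rw [hz2, hg.beta_eq_id (2+1) (by norm_num)]
        linarith
    have h5 := h1.trans h3
    rwa [div_le_one (by linarith)] at h5
  have key2 : ∀ x y : ℝ, 0 ≤ x → x ≤ y → |β x - β y| ≤ |x - y| := by
    intro x y hx hxy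
    rcases hxy.eq_or_lt with rfl | h
    · simp
    rw [abs_sub_comm, abs_sub_comm x, abs_of_nonneg, abs_of_nonneg]
    · exact key x y hx h
    · linarith
    · exact sub_nonneg.2 (hg.mono_beta hx (hx.trans hxy) hxy)
  apply LipschitzWith.of_dist_le_mul
  intro x y
  rw [hg.g_eq, hg.g_eq, Real.dist_eq, NNReal.coe_one, one_mul, dist_eq_norm]
  refine le_trans ?_ (abs_norm_sub_norm_le x y)
  rcases le_total ‖x‖ ‖y‖ with h | h
  · exact key2 _ _ (norm_nonneg _) h
  · rw [abs_sub_comm, abs_sub_comm ‖x‖]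
    exact key2 _ _ (norm_nonneg _) h

lemma grad_norm_le {g : R3 → ℝ} {β : ℝ → ℝ} (hg : GoodG g β) (x : R3) : ‖gradient g x‖ ≤ 1 := by
  have := norm_fderiv_le_of_lipschitz ℝ (x₀ := x) (g_lip hg)
  simpa [gradient] using this

lemma grad_continuous {g : R3 → ℝ} {β : ℝ → ℝ} (hg : GoodG g β) : Continuous (gradient g) := by
  unfold gradient
  exact (LinearIsometryEquiv.continuous _).comp
    (hg.smooth_g.continuous_fderiv (by simp))

lemma one_add_one_le_top : (1 : WithTop ℕ∞) + 1 ≤ ((⊤ : ℕ∞) : WithTop ℕ∞) := by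
  have : (1 : WithTop ℕ∞) + 1 = ((1 + 1 : ℕ∞) : WithTop ℕ∞) := by norm_cast
  rw [this]
  exact WithTop.coe_le_coe.2 le_top

lemma integral_by_parts_im {u : R3 → ℂ} {w : R3 → ℝ} (hu : ContDiff ℝ (⊤ : ℕ∞) u)
    (hw : ContDiff ℝ 1 w) (hs : HasCompactSupport w) :
    ∫ x, w x * ((starRingEnd ℂ) (u x) * laplacian u x).im =
      -∫ x, ((starRingEnd ℂ) (u x) * fderiv ℝ u x (gradient w x)).im := by
  have hu1 : ContDiff ℝ 1 u := hu.of_le (by exact_mod_cast le_top)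
  have hud : ∀ v, ContDiff ℝ 1 (fun y => fderiv ℝ u y v) := fun v =>
    (hu.fderiv_right (m := 1) one_add_one_le_top).clm_apply contDiff_const
  set f : R3 → ℂ := fun x => w x • (starRingEnd ℂ) (u x) with hf
  have hcu : ContDiff ℝ 1 (fun x => (starRingEnd ℂ) (u x)) :=
    Complex.conjCLE.contDiff.comp hu1
  have hf1 : ContDiff ℝ 1 f := hw.smul hcu
  have hfs : HasCompactSupport f := hs.smul_right
  have hfd : ∀ x v, fderiv ℝ f x v =
      w x • (starRingEnd ℂ) (fderiv ℝ u x v) + fderiv ℝ w x v • (starRingEnd ℂ) (u x) := by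
    intro x v
    have h1 : HasFDerivAt (fun x => (starRingEnd ℂ) (u x))
        ((Complex.conjCLE : ℂ →L[ℝ] ℂ).comp (fderiv ℝ u x)) x :=
      (Complex.conjCLE : ℂ →L[ℝ] ℂ).hasFDerivAt.comp x
        (hu1.differentiable one_ne_zero).differentiableAt.hasFDerivAt
    have h2 := ((hw.differentiable one_ne_zero).differentiableAt (x := x)).hasFDerivAt.smul h1
    have h3 : fderiv ℝ f x = _ := h2.fderiv
    rw [h3]
    simp
  have hfdc : ∀ v, Continuous fun x => fderiv ℝ f x v := fun v =>
    (hf1.continuous_fderiv one_ne_zero).clm_apply continuous_const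
  have hddc : ∀ v, Continuous fun x => fderiv ℝ (fun y => fderiv ℝ u y v) x v := fun v =>
    ((hud v).continuous_fderiv one_ne_zero).clm_apply continuous_const
  have i1 : ∀ v, Integrable fun x => fderiv ℝ f x v * fderiv ℝ u x v := fun v =>
    ((hfdc v).mul (hud v).continuous).integrable_of_hasCompactSupport
      ((hfs.fderiv_apply (𝕜 := ℝ) v).mul_right)
  have i2 : ∀ v, Integrable fun x => f x * fderiv ℝ (fun y => fderiv ℝ u y v) x v := fun v =>
    (hf1.continuous.mul (hddc v)).integrable_of_hasCompactSupport hfs.mul_right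
  have i3 : ∀ v, Integrable fun x => f x * fderiv ℝ u x v := fun v =>
    (hf1.continuous.mul (hud v).continuous).integrable_of_hasCompactSupport hfs.mul_right
  have ibp : ∀ v, ∫ x, f x * fderiv ℝ (fun y => fderiv ℝ u y v) x v =
      -∫ x, fderiv ℝ f x v * fderiv ℝ u x v := fun v =>
    integral_mul_fderiv_eq_neg_fderiv_mul_of_integrable (i1 v) (i2 v) (i3 v)
      (fun x _ => (hf1.differentiable one_ne_zero).differentiableAt)
      (fun x _ => ((hud v).differentiable one_ne_zero).differentiableAt)
  have hL : ∫ x, f x * laplacian u x =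
      -∫ x, ∑ j : Fin 3, fderiv ℝ f x (EuclideanSpace.single j 1) *
        fderiv ℝ u x (EuclideanSpace.single j 1) := by
    unfold laplacian
    simp_rw [Finset.mul_sum]
    rw [integral_finsetSum _ fun j _ => i2 _, integral_finsetSum _ fun j _ => i1 _,
      ← Finset.sum_neg_distrib]
    exact Finset.sum_congr rfl fun j _ => ibp _
  have iL : Integrable fun x => f x * laplacian u x := by
    unfold laplacian
    simp_rw [Finset.mul_sum]
    exact integrable_finsetSum _ fun j _ => i2 _
  have iR : Integrable fun x => ∑ j : Fin 3, fderiv ℝ f x (EuclideanSpace.single j 1) *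
        fderiv ℝ u x (EuclideanSpace.single j 1) := integrable_finsetSum _ fun j _ => i1 _
  have hL2 := congrArg Complex.im hL
  have e1 := integral_im iL
  have e2 := integral_im iR
  simp only [RCLike.im_to_complex] at e1 e2
  rw [Complex.neg_im, ← e1, ← e2] at hL2
  convert hL2 using 1
  · refine integral_congr_ae (Eventually.of_forall fun x => ?_)
    simp [hf, mul_assoc]
  · congr 1
    refine integral_congr_ae (Eventually.of_forall fun x => ?_)
    simp only
    have hgr : gradient w x = ∑ j : Fin 3,
        fderiv ℝ w x (EuclideanSpace.single j 1) • EuclideanSpace.single j (1:ℝ) := by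
      ext i
      have : ∀ v, fderiv ℝ w x v = inner ℝ (gradient w x) v := by
        intro v; simp [gradient]
      have h2 : ∀ j, fderiv ℝ w x (EuclideanSpace.single j 1) = gradient w x j := by
        intro j
        rw [this, real_inner_comm, EuclideanSpace.inner_single_left]
        simp
      simp [h2, Finset.sum_apply, Pi.single_apply]
    rw [hgr, map_sum, Finset.mul_sum, Complex.im_sum, Complex.im_sum]
    refine Finset.sum_congr rfl fun j _ => ?_
    rw [hfd, map_smul]
    simp
    ring

lemma hasDerivAt_integral_cpt {f : ℝ × R3 → ℝ} {K : Set R3} (hK : IsCompact K)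
    (hf : ContDiffOn ℝ 1 f (Set.Ioi 0 ×ˢ Set.univ))
    (h0 : ∀ t x, 0 < t → x ∉ K → f (t, x) = 0) {t : ℝ} (ht : 0 < t) :
    Integrable (fun x => deriv (fun s => f (s, x)) t) ∧
    HasDerivAt (fun s => ∫ x, f (s, x)) (∫ x, deriv (fun s => f (s, x)) t) t := by
  have hU : IsOpen (Set.Ioi (0:ℝ) ×ˢ (Set.univ : Set R3)) := isOpen_Ioi.prod isOpen_univ
  have hder : ∀ s x, 0 < s → HasDerivAt (fun s => f (s, x)) (fderiv ℝ f (s, x) (1, 0)) s := by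
    intro s x hs
    have h1 : HasFDerivAt f (fderiv ℝ f (s, x)) (s, x) :=
      ((hf.differentiableOn one_ne_zero).differentiableAt
        (hU.mem_nhds (Set.mk_mem_prod hs trivial))).hasFDerivAt
    exact h1.comp_hasDerivAt s ((hasDerivAt_id s).prodMk (hasDerivAt_const s x))
  have hcont : ContinuousOn (fun p => fderiv ℝ f p (1, 0)) (Set.Ioi (0:ℝ) ×ˢ (Set.univ : Set R3)) :=
    (hf.continuousOn_fderiv_of_isOpen hU le_rfl).clm_apply continuousOn_const
  have hslice : ∀ s, 0 < s → Continuous fun x => f (s, x) := fun s hs =>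
    hf.continuousOn.comp_continuous (by fun_prop) fun x => ⟨hs, trivial⟩
  have hsl' : ∀ s, 0 < s → Continuous fun x => deriv (fun s => f (s, x)) s := fun s hs => by
    have : (fun x => deriv (fun s => f (s, x)) s) = fun x => fderiv ℝ f (s, x) (1, 0) :=
      funext fun x => (hder s x hs).deriv
    rw [this]
    exact hcont.comp_continuous (f := fun x => (s, x)) (by fun_prop) fun x => ⟨hs, trivial⟩
  have hz : ∀ s x, 0 < s → x ∉ K → deriv (fun s => f (s, x)) s = 0 := by
    intro s x hs hx
    have : (fun s => f (s, x)) =ᶠ[𝓝 s] fun _ => 0 := by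
      filter_upwards [Ioi_mem_nhds hs] with r hr using h0 r x hr hx
    rw [this.deriv_eq]; simp
  obtain ⟨C, hC⟩ := ((isCompact_Icc (a := t / 2) (b := 2 * t)).prod
    hK).exists_bound_of_continuousOn (hcont.mono fun p hp => ⟨by
      have := hp.1.1; simp only [Set.mem_Ioi]; linarith, trivial⟩)
  refine hasDerivAt_integral_of_dominated_loc_of_deriv_le (s := Set.Icc (t / 2) (2 * t))
    (bound := K.indicator fun _ => C) (F := fun s x => f (s, x))
    (F' := fun s x => deriv (fun s => f (s, x)) s)
    (Icc_mem_nhds (by linarith) (by linarith)) ?_ ?_ ?_ ?_ ?_ ?_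
  · filter_upwards [Ioi_mem_nhds ht] with s hs using (hslice s hs).aestronglyMeasurable
  · exact (hslice t ht).integrable_of_hasCompactSupport
      (HasCompactSupport.intro hK fun x hx => h0 t x ht hx)
  · exact (hsl' t ht).aestronglyMeasurable
  · refine Eventually.of_forall fun x s hs => ?_
    have hs0 : 0 < s := by linarith [hs.1]
    by_cases hx : x ∈ K
    · rw [Set.indicator_of_mem hx, (hder s x hs0).deriv]
      exact hC (s, x) ⟨hs, hx⟩
    · rw [Set.indicator_of_notMem hx, hz s x hs0 hx]; simp
  · exact (integrable_indicator_iff hK.measurableSet).2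
      (integrableOn_const hK.measure_lt_top.ne)
  · refine Eventually.of_forall fun x s hs => ?_
    have hs0 : 0 < s := by linarith [hs.1]
    exact (hder s x hs0).differentiableAt.hasDerivAt

lemma phi_open {N : ℝ → ℝ → ℝ → ℝ} {φ : ℝ → R3 → ℂ} (hφ : SolSetting N φ) :
    ContDiffOn ℝ (⊤ : ℕ∞) (fun p : ℝ × R3 => φ p.1 p.2) (Set.Ioi 0 ×ˢ Set.univ) :=
  hφ.smooth.mono fun _ hp => ⟨Set.mem_Ici.2 (le_of_lt hp.1), trivial⟩

lemma phi_slice {N : ℝ → ℝ → ℝ → ℝ} {φ : ℝ → R3 → ℂ} (hφ : SolSetting N φ) {t : ℝ} (ht : 0 < t) :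
    ContDiff ℝ (⊤ : ℕ∞) (φ t) := by
  have h : ContDiff ℝ (⊤ : ℕ∞) (fun x : R3 => ((t, x) : ℝ × R3)) := by fun_prop
  have := (phi_open hφ).comp (s := Set.univ) h.contDiffOn fun x _ => ⟨ht, trivial⟩
  exact contDiffOn_univ.1 this

lemma phi_t {N : ℝ → ℝ → ℝ → ℝ} {φ : ℝ → R3 → ℂ} (hφ : SolSetting N φ) {t : ℝ} (ht : 0 < t)
    (x : R3) : DifferentiableAt ℝ (fun s => φ s x) t := by
  have hU : IsOpen (Set.Ioi (0:ℝ) ×ˢ (Set.univ : Set R3)) := isOpen_Ioi.prod isOpen_univ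
  have h1 : DifferentiableAt ℝ (fun p : ℝ × R3 => φ p.1 p.2) (t, x) :=
    ((phi_open hφ).differentiableOn (by simp)).differentiableAt (hU.mem_nhds ⟨ht, trivial⟩)
  exact h1.comp (f := fun s => (s, x)) t (by fun_prop)

lemma phi_grad_cont {N : ℝ → ℝ → ℝ → ℝ} {φ : ℝ → R3 → ℂ} (hφ : SolSetting N φ)
    {G : R3 → R3} (hG : Continuous G) :
    ContinuousOn (fun p : ℝ × R3 => fderiv ℝ (φ p.1) p.2 (G p.2)) (Set.Ioi 0 ×ˢ Set.univ) := by
  have hU : IsOpen (Set.Ioi (0:ℝ) ×ˢ (Set.univ : Set R3)) := isOpen_Ioi.prod isOpen_univ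
  have h2 : ContinuousOn (fun p : ℝ × R3 =>
      fderiv ℝ (fun p : ℝ × R3 => φ p.1 p.2) p ((0, G p.2) : ℝ × R3)) (Set.Ioi 0 ×ˢ Set.univ) :=
    ((phi_open hφ).continuousOn_fderiv_of_isOpen hU (by exact_mod_cast le_top)).clm_apply
      (by fun_prop)
  refine h2.congr fun p hp => ?_
  obtain ⟨t, x⟩ := p
  have h1 : DifferentiableAt ℝ (fun p : ℝ × R3 => φ p.1 p.2) (t, x) :=
    ((phi_open hφ).differentiableOn (by simp)).differentiableAt (hU.mem_nhds hp)
  have h3 := h1.hasFDerivAt.comp (f := fun y : R3 => (t, y)) x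
    ((hasFDerivAt_const t x).prodMk (hasFDerivAt_id x))
  have h4 : fderiv ℝ (φ t) x = _ := h3.fderiv
  simp only
  rw [h4]
  simp

/-- The current density. -/
def JJ (g : R3 → ℝ) (φ : ℝ → R3 → ℂ) (t : ℝ) (x : R3) : ℝ :=
  ((starRingEnd ℂ) (φ t x) * fderiv ℝ (φ t) x (gradient g x)).im

lemma JJ_cont {N : ℝ → ℝ → ℝ → ℝ} {φ : ℝ → R3 → ℂ} (hφ : SolSetting N φ) {g : R3 → ℝ} {β : ℝ → ℝ}
    (hg : GoodG g β) :
    ContinuousOn (fun p : ℝ × R3 => JJ g φ p.1 p.2) (Set.Ioi 0 ×ˢ Set.univ) := by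
  unfold JJ
  exact Complex.continuous_im.comp_continuousOn
    ((Complex.continuous_conj.comp_continuousOn (phi_open hφ).continuousOn).mul
      (phi_grad_cont hφ (grad_continuous hg)))

lemma phi_prod_le {φ : ℝ → R3 → ℂ} {g : R3 → ℝ} {β : ℝ → ℝ} (hg : GoodG g β) (t : ℝ) (x : R3) :
    ‖(starRingEnd ℂ) (φ t x) * fderiv ℝ (φ t) x (gradient g x)‖ ≤
      ‖φ t x‖ ^ 2 + ‖fderiv ℝ (φ t) x‖ ^ 2 := by
  rw [norm_mul, RCLike.norm_conj]
  have h1 : ‖fderiv ℝ (φ t) x (gradient g x)‖ ≤ ‖fderiv ℝ (φ t) x‖ := by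
    refine ((fderiv ℝ (φ t) x).le_opNorm _).trans ?_
    exact mul_le_of_le_one_right (norm_nonneg _) (grad_norm_le hg x)
  nlinarith [norm_nonneg (φ t x), norm_nonneg (fderiv ℝ (φ t) x),
    sq_nonneg (‖φ t x‖ - ‖fderiv ℝ (φ t) x‖), norm_nonneg (fderiv ℝ (φ t) x (gradient g x))]

lemma JJ_le {φ : ℝ → R3 → ℂ} {g : R3 → ℝ} {β : ℝ → ℝ} (hg : GoodG g β) (t : ℝ) (x : R3) :
    |JJ g φ t x| ≤ ‖φ t x‖ ^ 2 + ‖fderiv ℝ (φ t) x‖ ^ 2 :=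
  (Complex.abs_im_le_norm _).trans (phi_prod_le hg t x)

lemma GammaF_eq {N : ℝ → ℝ → ℝ → ℝ} {φ : ℝ → R3 → ℂ} (hφ : SolSetting N φ) {g : R3 → ℝ}
    {β : ℝ → ℝ} (hg : GoodG g β) {F : ℝ → ℝ} (hF : IsSmoothChar F) {α t : ℝ} (ht : 0 < t) :
    GammaF g φ F α t = ∫ x, F (g x / t ^ α) ^ 2 * JJ g φ t x := by
  have hp : 0 < t ^ α := rpow_pos_of_pos ht α
  obtain ⟨C, hC0, hC, -⟩ := dF_bound hF
  set c : R3 → ℝ := fun x => F (g x / t ^ α) with hc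
  have hg1 : ContDiff ℝ 1 g := hg.smooth_g.of_le (by exact_mod_cast le_top)
  have hF1 : ContDiff ℝ 1 F := hF.1.of_le (by exact_mod_cast le_top)
  have hφ1 : ContDiff ℝ 1 (φ t) := (phi_slice hφ ht).of_le (by exact_mod_cast le_top)
  have hc1 : ContDiff ℝ 1 c := hF1.comp (hg1.div_const _)
  have hcd : ∀ x, |fderiv ℝ c x (gradient g x)| ≤ C / t ^ α := by
    intro x
    have hgx : HasFDerivAt g (fderiv ℝ g x) x :=
      (hg1.differentiable one_ne_zero).differentiableAt.hasFDerivAt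
    have h1 : HasFDerivAt (fun y => g y / t ^ α) ((t ^ α)⁻¹ • fderiv ℝ g x) x := by
      have : (fun y => g y / t ^ α) = (t ^ α)⁻¹ • g := by
        ext y; simp [div_eq_inv_mul]
      rw [this]
      exact hgx.const_smul (t ^ α)⁻¹
    have h2 : HasFDerivAt c _ x :=
      (hF1.differentiable one_ne_zero (g x / t ^ α)).hasDerivAt.comp_hasFDerivAt x h1
    rw [h2.fderiv]
    have h3 : |fderiv ℝ g x (gradient g x)| ≤ 1 := by
      have a := (fderiv ℝ g x).le_opNorm (gradient g x)
      have b := norm_fderiv_le_of_lipschitz ℝ (x₀ := x) (g_lip hg)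
      have d := grad_norm_le hg x
      rw [Real.norm_eq_abs] at a
      refine a.trans (mul_le_one₀ (by simpa using b) (norm_nonneg _) d)
    simp only [_root_.smul_apply, smul_eq_mul, abs_mul]
    rw [abs_of_pos (inv_pos.2 hp), div_eq_mul_inv]
    refine mul_le_mul (hC _) ?_ (by positivity) hC0
    exact mul_le_of_le_one_right (by positivity) h3
  set ψ : R3 → ℂ := fun x => c x • φ t x with hψ
  have hψ1 : ContDiff ℝ 1 ψ := hc1.smul hφ1
  have hψd : ∀ x v, fderiv ℝ ψ x v = c x • fderiv ℝ (φ t) x v + fderiv ℝ c x v • φ t x := by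
    intro x v
    have h2 := ((hc1.differentiable one_ne_zero).differentiableAt (x := x)).hasFDerivAt.smul
      ((hφ1.differentiable one_ne_zero).differentiableAt (x := x)).hasFDerivAt
    have h3 : fderiv ℝ ψ x = _ := h2.fderiv
    rw [h3]
    simp
  have hGe : GammaF g φ F α t = gammaExp g ψ := by
    unfold GammaF
    congr 1
  have hc01 : ∀ x, 0 ≤ c x ∧ c x ≤ 1 := fun x => hF.2.2.2.2 _
  have hexp : ∀ x, (starRingEnd ℂ) (ψ x) * fderiv ℝ ψ x (gradient g x) =
      (c x ^ 2) • ((starRingEnd ℂ) (φ t x) * fderiv ℝ (φ t) x (gradient g x)) +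
      (c x * fderiv ℝ c x (gradient g x)) • ((‖φ t x‖ ^ 2 : ℝ) : ℂ) := by
    intro x
    rw [hψd, ← Complex.normSq_eq_norm_sq, Complex.normSq_eq_conj_mul_self]
    simp [hψ]
    ring
  have hint : Integrable fun x => (starRingEnd ℂ) (ψ x) * fderiv ℝ ψ x (gradient g x) := by
    refine Integrable.mono' (g := fun x => (‖φ t x‖ ^ 2 + ‖fderiv ℝ (φ t) x‖ ^ 2) +
      C / t ^ α * ‖φ t x‖ ^ 2)
      (((hφ.l2 t ht.le).add (hφ.grad_l2 t ht.le)).add ((hφ.l2 t ht.le).const_mul _)) ?_ ?_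
    · exact ((Complex.continuous_conj.comp hψ1.continuous).mul
        ((hψ1.continuous_fderiv one_ne_zero).clm_apply
          (grad_continuous hg))).aestronglyMeasurable
    · refine Eventually.of_forall fun x => ?_
      rw [hexp]
      refine (norm_add_le _ _).trans (add_le_add ?_ ?_)
      · rw [norm_smul]
        obtain ⟨a, b⟩ := hc01 x
        refine le_trans (mul_le_of_le_one_left (norm_nonneg _) ?_) (phi_prod_le hg t x)
        rw [Real.norm_eq_abs, abs_of_nonneg (by positivity)]
        nlinarith
      · rw [norm_smul, Complex.norm_real, Real.norm_eq_abs, Real.norm_eq_abs,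
          abs_of_nonneg (sq_nonneg ‖φ t x‖)]
        refine mul_le_mul_of_nonneg_right ?_ (sq_nonneg _)
        obtain ⟨a, b⟩ := hc01 x
        rw [abs_mul, abs_of_nonneg a]
        exact (mul_le_of_le_one_left (abs_nonneg _) b).trans (hcd x)
  rw [hGe]
  unfold gammaExp
  have e1 := integral_im hint
  simp only [RCLike.im_to_complex] at e1
  rw [← e1]
  refine integral_congr_ae (Eventually.of_forall fun x => ?_)
  simp only
  rw [hexp, Complex.add_im, Complex.smul_im, Complex.smul_im, Complex.ofReal_im]
  simp [JJ, hc]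

/-- Truncated current. -/
def GN (g : R3 → ℝ) (φ : ℝ → R3 → ℂ) (F : ℝ → ℝ) (α R t : ℝ) : ℝ :=
  ∫ x, DD F α R t (g x) * JJ g φ t x

lemma GN_cont {N : ℝ → ℝ → ℝ → ℝ} {φ : ℝ → R3 → ℂ} (hφ : SolSetting N φ) {g : R3 → ℝ}
    {β : ℝ → ℝ} (hg : GoodG g β) {F : ℝ → ℝ} (hF : IsSmoothChar F) {α R : ℝ} (hR : 0 < R) :
    ContinuousOn (GN g φ F α R) (Set.Ioi 0) := by
  unfold GN
  refine continuousOn_integral_of_compact_support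
    (k := Metric.closedBall (0 : R3) (|R| + 2)) (isCompact_closedBall _ _) ?_ ?_
  · exact (DD_continuousOn hF hg.smooth_g).mul (JJ_cont hφ hg)
  · intro t x _ hx
    rw [DD_zero hF hR (g_large hg x hx), zero_mul]

lemma mass_deriv {N : ℝ → ℝ → ℝ → ℝ} {φ : ℝ → R3 → ℂ} (hφ : SolSetting N φ) {g : R3 → ℝ}
    {β : ℝ → ℝ} (hg : GoodG g β) {F : ℝ → ℝ} (hF : IsSmoothChar F) {α R : ℝ} (hα : 0 < α)
    (hR : 0 < R) {t : ℝ} (ht : 0 < t) :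
    ∃ d ≤ 2 * GN g φ F α R t,
      HasDerivAt (fun s => ∫ x, VV F α R s (g x) * ‖φ s x‖ ^ 2) d t := by
  have hK : IsCompact (Metric.closedBall (0 : R3) (|R| + 2)) := isCompact_closedBall _ _
  have hVs : ∀ s x, x ∉ Metric.closedBall (0 : R3) (|R| + 2) → VV F α R s (g x) = 0 :=
    fun s x hx => VV_zero hF hR (g_large hg x hx).le
  have hcd : ContDiffOn ℝ 1 (fun p : ℝ × R3 => VV F α R p.1 (g p.2) * ‖φ p.1 p.2‖ ^ 2)
      (Set.Ioi 0 ×ˢ Set.univ) :=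
    (VV_contDiffOn hF hg.smooth_g).mul
      (((phi_open hφ).of_le (by exact_mod_cast le_top)).norm_sq ℝ)
  obtain ⟨hi, hd⟩ := hasDerivAt_integral_cpt hK hcd
    (fun s x _ hx => by simp [hVs s x hx]) ht
  refine ⟨_, ?_, hd⟩
  have hu := phi_slice hφ ht
  have hw : ContDiff ℝ 1 (fun x => VV F α R t (g x)) := by
    have h : ContDiff ℝ 1 (fun x : R3 => ((t, x) : ℝ × R3)) := by fun_prop
    have := (VV_contDiffOn hF (α := α) (R := R) hg.smooth_g).comp (s := Set.univ) h.contDiffOn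
      fun x _ => Set.mk_mem_prod ht trivial
    exact contDiffOn_univ.1 this
  have hws : HasCompactSupport (fun x => VV F α R t (g x)) :=
    HasCompactSupport.intro hK (hVs t)
  have hibp := integral_by_parts_im hu hw hws
  have hgrad : ∀ x, gradient (fun x => VV F α R t (g x)) x = DD F α R t (g x) • gradient g x := by
    intro x
    have h1 : HasFDerivAt g (fderiv ℝ g x) x :=
      (hg.smooth_g.differentiable (by simp)).differentiableAt.hasFDerivAt
    have h2 : HasFDerivAt (fun x => VV F α R t (g x)) _ x :=
      (VV_hasDerivAt_y hF (α := α) (R := R) ht (g x)).comp_hasFDerivAt x h1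
    unfold gradient
    rw [h2.fderiv]
    simp
  have hGN : ∫ x, VV F α R t (g x) * ((starRingEnd ℂ) (φ t x) * laplacian (φ t) x).im =
      - GN g φ F α R t := by
    rw [hibp]
    unfold GN JJ
    congr 1
    refine integral_congr_ae (Eventually.of_forall fun x => ?_)
    simp only
    rw [hgrad, map_smul, mul_smul_comm, Complex.smul_im, smul_eq_mul]
  have hlap : Continuous (laplacian (φ t)) := by
    unfold laplacian
    refine continuous_finsetSum _ fun j _ => ?_
    have : ContDiff ℝ 1 (fun y => fderiv ℝ (φ t) y (EuclideanSpace.single j 1)) :=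
      (hu.fderiv_right (m := 1) one_add_one_le_top).clm_apply contDiff_const
    exact (this.continuous_fderiv one_ne_zero).clm_apply continuous_const
  have hi2 : Integrable fun x =>
      VV F α R t (g x) * ((starRingEnd ℂ) (φ t x) * laplacian (φ t) x).im :=
    (hw.continuous.mul (Complex.continuous_im.comp
      ((Complex.continuous_conj.comp hu.continuous).mul hlap))).integrable_of_hasCompactSupport
      hws.mul_right
  have : 2 * GN g φ F α R t = ∫ x, -2 *
      (VV F α R t (g x) * ((starRingEnd ℂ) (φ t x) * laplacian (φ t) x).im) := by
    rw [integral_const_mul, hGN]; ring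
  rw [this]
  refine integral_mono hi (hi2.const_mul _) fun x => ?_
  obtain ⟨v, hv, hvd⟩ := VV_hasDerivAt_t hF (α := α) (R := R) hα ht (g x)
  have hφd := (phi_t hφ ht x).hasDerivAt
  have hprod := hvd.mul hφd.norm_sq
  have he : deriv (fun s => VV F α R s (g x) * ‖φ s x‖ ^ 2) t = _ := hprod.deriv
  simp only
  rw [he]
  have heq := hφ.eqn t ht.le x
  set z := φ t x with hz
  set d := deriv (fun s => φ s x) t with hdd
  set l := laplacian (φ t) x with hl
  have hin : inner ℝ z d = - ((starRingEnd ℂ) z * l).im := by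
    have hr := congrArg Complex.re heq
    have him := congrArg Complex.im heq
    simp at hr him
    rw [Complex.inner]
    simp
    have e1 : d.re = N ‖z‖ ‖x‖ t * z.im - l.im := by linarith
    have e2 : d.im = l.re - N ‖z‖ ‖x‖ t * z.re := by linarith
    rw [e1, e2]
    ring
  rw [hin]
  have : v * ‖z‖ ^ 2 ≤ 0 := mul_nonpos_of_nonpos_of_nonneg hv (sq_nonneg _)
  linarith

lemma GN_bound {N : ℝ → ℝ → ℝ → ℝ} {φ : ℝ → R3 → ℂ} (hφ : SolSetting N φ) {g : R3 → ℝ}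
    {β : ℝ → ℝ} (hg : GoodG g β) {F : ℝ → ℝ} (hF : IsSmoothChar F) (α : ℝ) :
    ∃ C : ℝ, ∀ R t : ℝ, 0 < R → 0 < t → ‖GN g φ F α R t‖ ≤ C := by
  obtain ⟨C, hC0, hC⟩ := DD_bound hF
  obtain ⟨E, hE⟩ := hφ.H1
  refine ⟨C * E, fun R t hR ht => ?_⟩
  have hi := (hφ.l2 t ht.le).add (hφ.grad_l2 t ht.le)
  calc ‖GN g φ F α R t‖ ≤ ∫ x, C * (‖φ t x‖ ^ 2 + ‖fderiv ℝ (φ t) x‖ ^ 2) := by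
        refine norm_integral_le_of_norm_le (hi.const_mul C) (Eventually.of_forall fun x => ?_)
        rw [norm_mul]
        exact mul_le_mul (hC _ _ _ _ hR ht) (JJ_le hg t x) (norm_nonneg _) hC0
    _ = C * ((∫ x, ‖φ t x‖ ^ 2) + ∫ x, ‖fderiv ℝ (φ t) x‖ ^ 2) := by
        rw [integral_const_mul, integral_add (hφ.l2 t ht.le) (hφ.grad_l2 t ht.le)]
    _ ≤ C * E := mul_le_mul_of_nonneg_left (hE t ht.le) hC0

lemma GN_tendsto {N : ℝ → ℝ → ℝ → ℝ} {φ : ℝ → R3 → ℂ} (hφ : SolSetting N φ) {g : R3 → ℝ}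
    {β : ℝ → ℝ} (hg : GoodG g β) {F : ℝ → ℝ} (hF : IsSmoothChar F) {α t : ℝ} (ht : 0 < t) :
    Tendsto (fun n : ℕ => GN g φ F α ((n:ℝ) + 1) t) atTop (𝓝 (GammaF g φ F α t)) := by
  rw [GammaF_eq hφ hg hF ht]
  obtain ⟨C, hC0, hC⟩ := DD_bound hF
  have hi := (hφ.l2 t ht.le).add (hφ.grad_l2 t ht.le)
  have hcx : Continuous (fun x : R3 => ((t, x) : ℝ × R3)) := by fun_prop
  refine tendsto_integral_of_dominated_convergence
    (fun x => C * (‖φ t x‖ ^ 2 + ‖fderiv ℝ (φ t) x‖ ^ 2)) ?_ (hi.const_mul C) ?_ ?_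
  · intro n
    exact (((DD_continuousOn hF hg.smooth_g).mul (JJ_cont hφ hg)).comp_continuous hcx
      fun x => Set.mk_mem_prod ht trivial).aestronglyMeasurable
  · refine fun n => Eventually.of_forall fun x => ?_
    rw [norm_mul]
    exact mul_le_mul (hC _ _ _ _ (by positivity) ht) (JJ_le hg t x) (norm_nonneg _) hC0
  · refine Eventually.of_forall fun x => ?_
    refine tendsto_const_nhds.congr' ?_
    filter_upwards [DD_eventually hF α t (g x)] with n hn
    rw [hn]

lemma mass_lower {N : ℝ → ℝ → ℝ → ℝ} {φ : ℝ → R3 → ℂ} (hφ : SolSetting N φ) {g : R3 → ℝ}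
    {β : ℝ → ℝ} (hg : GoodG g β) {F : ℝ → ℝ} (hF : IsSmoothChar F) {α : ℝ} (hα : 0 < α)
    {a : ℝ} (ha : 0 < a) :
    ∃ M : ℝ, ∀ R b : ℝ, 0 < R → a ≤ b → -M ≤ ∫ t in a..b, 2 * GN g φ F α R t := by
  refine ⟨∫ x, (|g 0| + 1) * ((1 + ‖x‖) * ‖φ a x‖ ^ 2), fun R b hR hab => ?_⟩
  set m : ℝ → ℝ := fun s => ∫ x, VV F α R s (g x) * ‖φ s x‖ ^ 2 with hm
  have hex : ∀ t, 0 < t → ∃ d ≤ 2 * GN g φ F α R t, HasDerivAt m d t := fun t ht =>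
    mass_deriv hφ hg hF hα hR ht
  choose! d hd1 hd2 using hex
  have hmain := intervalIntegral.sub_le_integral_of_hasDeriv_right_of_le (g := m) (g' := d)
    (φ := fun t => 2 * GN g φ F α R t) hab
    (fun t ht => (hd2 t (ha.trans_le ht.1)).continuousAt.continuousWithinAt)
    (fun t ht => (hd2 t (ha.trans ht.1)).hasDerivWithinAt)
    (((continuousOn_const.mul (GN_cont hφ hg hF hR)).mono
      fun t ht => ha.trans_le ht.1).integrableOn_Icc)
    (fun t ht => hd1 t (ha.trans ht.1))
  have hmb : 0 ≤ m b := integral_nonneg fun x =>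
    mul_nonneg (VV_nonneg hF (ha.trans_le hab) _).1 (sq_nonneg _)
  have hma : m a ≤ ∫ x, (|g 0| + 1) * ((1 + ‖x‖) * ‖φ a x‖ ^ 2) := by
    refine integral_mono_of_nonneg (Eventually.of_forall fun x =>
      mul_nonneg (VV_nonneg hF ha _).1 (sq_nonneg _)) ((hφ.wt_l2 a ha.le).const_mul _)
      (Eventually.of_forall fun x => ?_)
    simp only
    rw [← mul_assoc]
    refine mul_le_mul_of_nonneg_right ((VV_nonneg hF ha _).2.trans ?_) (sq_nonneg _)
    have h1 := (g_lip hg).dist_le_mul x 0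
    rw [Real.dist_eq, NNReal.coe_one, one_mul, dist_zero_right] at h1
    have h2 : |g x| ≤ |g x - g 0| + |g 0| := by
      simpa using abs_add_le (g x - g 0) (g 0)
    nlinarith [norm_nonneg x, abs_nonneg (g 0), mul_nonneg (norm_nonneg x) (abs_nonneg (g 0))]
  linarith

/-- Non-negativity of the γ-limit: if `Γ_{F,α}(t) → L` then `L ≥ 0`. -/
theorem gamma_limit_nonneg
    (g : R3 → ℝ) (β : ℝ → ℝ) (N : ℝ → ℝ → ℝ → ℝ) (φ : ℝ → R3 → ℂ)
    (hg : GoodG g β) (hφ : SolSetting N φ)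
    (α : ℝ) (hα : α ∈ Set.Ioo (1 / 3 : ℝ) 1)
    (hH2 : ∃ β₀ > (1 : ℝ), H2 g N φ α β₀)
    (F : ℝ → ℝ) (hF : IsSmoothChar F)
    (L : ℝ) (hL : Tendsto (fun t => GammaF g φ F α t) atTop (𝓝 L)) :
    0 ≤ L := by
  by_contra hneg
  push Not at hneg
  have hα0 : 0 < α := by linarith [hα.1]
  obtain ⟨a, ha⟩ := eventually_atTop.1
    ((hL.eventually (Iio_mem_nhds (show L < L / 2 by linarith))).and (eventually_gt_atTop 0))
  have ha0 : 0 < a := (ha a le_rfl).2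
  obtain ⟨M, hM⟩ := mass_lower hφ hg hF hα0 ha0
  obtain ⟨C, hC⟩ := GN_bound hφ hg hF α
  have key : ∀ b, a ≤ b → -M ≤ L * (b - a) := by
    intro b hab
    have hpos : ∀ t ∈ Set.uIoc a b, 0 < t := fun t ht => by
      rw [Set.uIoc_of_le hab] at ht
      exact ha0.trans ht.1
    have hcn : ∀ n : ℕ, ContinuousOn (fun t => 2 * GN g φ F α ((n:ℝ) + 1) t)
        (Set.uIcc a b) := fun n => by
      rw [Set.uIcc_of_le hab]
      exact continuousOn_const.mul ((GN_cont hφ hg hF (by positivity)).mono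
        fun t ht => ha0.trans_le ht.1)
    have hlim := intervalIntegral.tendsto_integral_filter_of_dominated_convergence
      (μ := volume) (a := a) (b := b) (l := atTop)
      (F := fun (n : ℕ) t => 2 * GN g φ F α ((n:ℝ) + 1) t)
      (f := fun t => 2 * GammaF g φ F α t) (fun _ => 2 * C)
      (Eventually.of_forall fun n =>
        (((hcn n).mono Set.uIoc_subset_uIcc).aestronglyMeasurable measurableSet_uIoc))
      (Eventually.of_forall fun n => Eventually.of_forall fun t ht => by
        rw [norm_mul, Real.norm_two]
        exact mul_le_mul_of_nonneg_left (hC _ t (by positivity) (hpos t ht)) (by norm_num))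
      (by simp)
      (Eventually.of_forall fun t ht => (GN_tendsto hφ hg hF (hpos t ht)).const_mul 2)
    have h1 : -M ≤ ∫ t in a..b, 2 * GammaF g φ F α t :=
      ge_of_tendsto hlim (Eventually.of_forall fun n => hM _ b (by positivity) hab)
    have hmeas : AEStronglyMeasurable (fun t => 2 * GammaF g φ F α t)
        (volume.restrict (Set.uIoc a b)) := by
      refine aestronglyMeasurable_of_tendsto_ae atTop
        (fun n : ℕ => ((hcn n).mono Set.uIoc_subset_uIcc).aestronglyMeasurable measurableSet_uIoc) ?_
      filter_upwards [ae_restrict_mem measurableSet_uIoc] with t ht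
      exact (GN_tendsto hφ hg hF (hpos t ht)).const_mul 2
    have hint : IntervalIntegrable (fun t => 2 * GammaF g φ F α t) volume a b := by
      refine (intervalIntegrable_const (c := 2 * C)).mono_fun' hmeas ?_
      filter_upwards [ae_restrict_mem measurableSet_uIoc] with t ht
      rw [norm_mul, Real.norm_two]
      refine mul_le_mul_of_nonneg_left ?_ (by norm_num)
      exact le_of_tendsto (GN_tendsto hφ hg hF (hpos t ht)).norm
        (Eventually.of_forall fun n => hC _ t (by positivity) (hpos t ht))
    have h3 : ∫ t in a..b, 2 * GammaF g φ F α t ≤ ∫ t in a..b, L := by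
      refine intervalIntegral.integral_mono_on hab hint (by simp) fun t ht => ?_
      have : GammaF g φ F α t < L / 2 := (ha t ht.1).1
      linarith
    rw [intervalIntegral.integral_const, smul_eq_mul] at h3
    linarith
  have hb := key (a + (|M| + 1) / (-L)) (by
    have : 0 ≤ (|M| + 1) / (-L) := div_nonneg (by positivity) (by linarith)
    linarith)
  have : L * (a + (|M| + 1) / (-L) - a) = -(|M| + 1) := by
    field_simp [hneg.ne]
    ring
  rw [this] at hb
  linarith [le_abs_self M]
end
end
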